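/- Let q be an odd prime power, d ≥ 2, and let Q be a non-degenerate quadratic form on F_q^d. Let n, t be positive integers and let A ⊆ F_q^d with |A| = α q^d and α ≥ 12 n² q^{t − (d+1)/2}. Then for every distance graph G on vertex set {1,…,n} with m edges and maximum vertex degree t, the number of injective maps ι : {1,…,n} → A satisfying Q(ι(i) − ι(j)) = λ_{i,j} for every edge {i,j} of G is at least (1/2) |A|^n q^{−m}. -/

import Mathlib

open Finset

section Stepanov
open Polynomial

theorem stepanov_aux {L : Type} [Field L] [Fintype L] (p e q ρ : ℕ) [ExpChar L p]
    (hr : p ^ e = q * ρ) (hq : 3 ≤ q) (hρ : 0 < ρ)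
    (hcard : Fintype.card L = (q * ρ) ^ 2) (Tt : L[X]) (hT : Tt.natDegree = 2 * ρ)
    (s : L) (Z : Finset L) (h0 : ∀ x ∈ Z, x ≠ 0)
    (hZ : ∀ x ∈ Z, ∃ w, Tt.eval x = x ^ ρ * w ∧ w + w ^ (q * ρ) = s) :
    Z.card ≤ q * ρ * ρ + 5 * (q * ρ) := by
  classical
  set r := q * ρ with hrdef
  have hTne : Tt ≠ 0 := by
    rintro rfl
    simp at hT
    omega
  let ι := Fin ρ × Fin (ρ + 3) × Fin q
  let Φ : ι → L[X] := fun z => X ^ (z.1 : ℕ) * X ^ (r * (z.2.1 : ℕ)) * Tt ^ (z.2.2 : ℕ) *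
    X ^ (ρ * (q - 1 - (z.2.2 : ℕ)))
  let Ut : L[X] := C s * X ^ ρ - Tt
  let Ψ : ι → L[X] := fun z => X ^ (r * (z.1 : ℕ)) * X ^ (z.2.1 : ℕ) * Ut ^ (z.2.2 : ℕ) *
    X ^ (ρ * (q - 1 - (z.2.2 : ℕ)))
  have hΦne : ∀ z, Φ z ≠ 0 := by
    intro z
    simp only [Φ]
    exact mul_ne_zero (mul_ne_zero (mul_ne_zero (pow_ne_zero _ X_ne_zero)
      (pow_ne_zero _ X_ne_zero)) (pow_ne_zero _ hTne)) (pow_ne_zero _ X_ne_zero)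
  have hΦdeg : ∀ z, (Φ z).natDegree = (z.1 : ℕ) + ρ * ((z.2.2 : ℕ) + q * (z.2.1 : ℕ)) + ρ * (q - 1) := by
    intro z
    have hj : (z.2.2 : ℕ) ≤ q - 1 := by have := z.2.2.2; omega
    obtain ⟨k, hk⟩ := Nat.exists_eq_add_of_le hj
    have hk' : q - 1 - (z.2.2 : ℕ) = k := by omega
    simp only [Φ]
    rw [natDegree_mul (mul_ne_zero (mul_ne_zero (pow_ne_zero _ X_ne_zero)
      (pow_ne_zero _ X_ne_zero)) (pow_ne_zero _ hTne)) (pow_ne_zero _ X_ne_zero),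
      natDegree_mul (mul_ne_zero (pow_ne_zero _ X_ne_zero)
      (pow_ne_zero _ X_ne_zero)) (pow_ne_zero _ hTne),
      natDegree_mul (pow_ne_zero _ X_ne_zero) (pow_ne_zero _ X_ne_zero), natDegree_pow Tt, hT, hk', hk]
    simp only [natDegree_pow, natDegree_X]
    simp only [hrdef]
    ring
  have hUdeg : Ut.natDegree ≤ 2 * ρ := by
    refine (natDegree_sub_le _ _).trans (max_le ?_ hT.le)
    refine (natDegree_C_mul_X_pow_le _ _).trans (by omega)
  have hΨdeg : ∀ z, (Ψ z).natDegree < r * ρ + r + (ρ + 3) := by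
    intro z
    have hj : (z.2.2 : ℕ) ≤ q - 1 := by have := z.2.2.2; omega
    obtain ⟨k, hk⟩ := Nat.exists_eq_add_of_le hj
    have hk' : q - 1 - (z.2.2 : ℕ) = k := by omega
    have hq1 : q = (z.2.2 : ℕ) + k + 1 := by omega
    have h1 := z.1.2
    have h2 := z.2.1.2
    have : (Ψ z).natDegree ≤ r * (z.1 : ℕ) + (z.2.1 : ℕ) + (z.2.2 : ℕ) * (2 * ρ) + ρ * k := by
      simp only [Ψ]
      refine natDegree_mul_le_of_le (natDegree_mul_le_of_le (natDegree_mul_le_of_le ?_ ?_)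
        (natDegree_pow_le_of_le _ hUdeg)) ?_
      · simp
      · simp
      · simp [hk']
    refine lt_of_le_of_lt this ?_
    have h3 : r * ((z.1 : ℕ) + 1) ≤ r * ρ := Nat.mul_le_mul_left _ h1
    have h4 : (z.2.2 : ℕ) * (2 * ρ) + ρ * k ≤ 2 * r := by
      have h5 : r = ((z.2.2 : ℕ) + k + 1) * ρ := hrdef.trans (congrArg (· * ρ) hq1)
      rw [h5]
      nlinarith [Nat.zero_le (ρ * k)]
    nlinarith
  -- linear dependence of the Ψ
  obtain ⟨c, hcne, hc⟩ : ∃ c : ι → L, c ≠ 0 ∧ ∑ z, C (c z) * Ψ z = 0 := by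
    let f : (ι → L) →ₗ[L] (Fin (r * ρ + r + (ρ + 3)) → L) :=
      { toFun := fun c k => (∑ z, C (c z) * Ψ z).coeff k
        map_add' := by
          intro c d
          ext k
          simp [add_mul, Finset.sum_add_distrib]
        map_smul' := by
          intro c d
          ext k
          simp [mul_assoc, Finset.mul_sum] }
    have hlt : Module.finrank L (Fin (r * ρ + r + (ρ + 3)) → L) < Module.finrank L (ι → L) := by
      simp only [Module.finrank_fintype_fun_eq_card, ι, Fintype.card_prod, Fintype.card_fin]
      have : ρ * ((ρ + 3) * q) = r * ρ + 3 * r := by rw [hrdef]; ring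
      rw [this]
      have : 3 * ρ ≤ r := Nat.mul_le_mul_right _ hq
      omega
    have hker := LinearMap.ker_ne_bot_of_finrank_lt (f := f) hlt
    obtain ⟨c, hc, hc0⟩ := (Submodule.ne_bot_iff _).1 hker
    refine ⟨c, hc0, ?_⟩
    ext k
    by_cases hk : k < r * ρ + r + (ρ + 3)
    · have := congrFun (LinearMap.mem_ker.1 hc) ⟨k, hk⟩
      simpa [f] using this
    · rw [coeff_zero]
      apply coeff_eq_zero_of_natDegree_lt
      refine lt_of_le_of_lt (natDegree_sum_le_of_forall_le (n := r * ρ + r + (ρ + 3) - 1) _ _ ?_) (by omega)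
      intro z _
      refine (natDegree_C_mul_le _ _).trans ?_
      have := hΨdeg z
      omega
  let H : L[X] := ∑ z, C (c z ^ r) * Φ z
  have hinj : ∀ z z' : ι, (Φ z).natDegree = (Φ z').natDegree → z = z' := by
    intro z z' h
    rw [hΦdeg, hΦdeg] at h
    have h' : (z.1 : ℕ) + ρ * ((z.2.2 : ℕ) + q * (z.2.1 : ℕ)) =
      (z'.1 : ℕ) + ρ * ((z'.2.2 : ℕ) + q * (z'.2.1 : ℕ)) := by omega
    have e1 := congrArg (· % ρ) h'
    have e2 := congrArg (· / ρ) h'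
    simp only [Nat.add_mul_mod_self_left, Nat.mod_eq_of_lt z.1.2, Nat.mod_eq_of_lt z'.1.2,
      Nat.add_mul_div_left _ _ hρ, Nat.div_eq_of_lt z.1.2, Nat.div_eq_of_lt z'.1.2, zero_add] at e1 e2
    have hq0 : 0 < q := by omega
    have e3 := congrArg (· % q) e2
    have e4 := congrArg (· / q) e2
    simp only [Nat.add_mul_mod_self_left, Nat.mod_eq_of_lt z.2.2.2, Nat.mod_eq_of_lt z'.2.2.2,
      Nat.add_mul_div_left _ _ hq0, Nat.div_eq_of_lt z.2.2.2, Nat.div_eq_of_lt z'.2.2.2, zero_add] at e3 e4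
    exact Prod.ext (Fin.ext e1) (Prod.ext (Fin.ext e4) (Fin.ext e3))
  have hHne : H ≠ 0 := by
    intro hH
    obtain ⟨z, hz⟩ := Function.ne_iff.1 hcne
    have hz' : c z ^ r ≠ 0 := pow_ne_zero _ hz
    have hd : H.degree = univ.sup fun i => (C (c i ^ r) * Φ i).degree := by
      apply degree_sum_eq_of_disjoint
      rintro x ⟨-, hx⟩ y ⟨-, hy⟩ hxy
      simp only [Function.onFun, Function.comp]
      intro hdeg
      apply hxy
      apply hinj
      have hx0 : c x ^ r ≠ 0 := by
        intro h; apply hx; rw [h]; simp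
      have hy0 : c y ^ r ≠ 0 := by
        intro h; apply hy; rw [h]; simp
      rw [degree_C_mul hx0, degree_C_mul hy0] at hdeg
      exact natDegree_eq_of_degree_eq hdeg
    have h2 : (C (c z ^ r) * Φ z).degree ≤ H.degree := by
      rw [hd]
      exact Finset.le_sup (f := fun i => (C (c i ^ r) * Φ i).degree) (mem_univ z)
    rw [hH, degree_zero, le_bot_iff, degree_eq_bot] at h2
    exact mul_ne_zero (C_ne_zero.2 hz') (hΦne z) h2
  have hHdeg : H.natDegree ≤ q * ρ * ρ + 5 * (q * ρ) := by
    refine natDegree_sum_le_of_forall_le _ _ ?_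
    intro z _
    refine (natDegree_C_mul_le _ _).trans ?_
    rw [hΦdeg]
    have h1 := z.1.2
    have h2 := z.2.1.2
    have h3 := z.2.2.2
    have h4 : (z.2.2 : ℕ) + q * (z.2.1 : ℕ) + 1 ≤ q * (ρ + 3) := by nlinarith
    have h5 : ρ * ((z.2.2 : ℕ) + q * (z.2.1 : ℕ) + 1) ≤ ρ * (q * (ρ + 3)) := Nat.mul_le_mul_left _ h4
    have h6 : ρ * (q - 1) ≤ ρ * q := Nat.mul_le_mul_left _ (by omega)
    nlinarith
  have hfix : ∀ x : L, x ^ (r * r) = x := by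
    intro x
    have := FiniteField.pow_card x
    rwa [hcard, sq] at this
  have hroot : ∀ x ∈ Z, H.eval x = 0 := by
    intro x hx
    obtain ⟨w, hw, hws⟩ := hZ x hx
    have hx0 := h0 x hx
    have hU : Ut.eval x = x ^ ρ * (w ^ r) := by
      simp only [Ut, eval_sub, eval_mul, eval_C, eval_pow, eval_X, hw]
      rw [← hws]; ring
    have hc' := congrArg (eval x) hc
    simp only [eval_finsetSum, eval_mul, eval_C, eval_zero, Ψ, eval_pow, eval_X, hU] at hc'
    have hpow : (H.eval x) ^ r = x ^ ((r - 1) * (ρ * (q - 1))) * 0 := by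
      rw [← hc']
      simp only [H, eval_finsetSum, eval_mul, eval_C, Φ, eval_pow, eval_X, hw]
      rw [← hr, sum_pow_char_pow, hr, Finset.mul_sum]
      refine Finset.sum_congr rfl fun z _ => ?_
      have hj : (z.2.2 : ℕ) ≤ q - 1 := by have := z.2.2.2; omega
      obtain ⟨k, hk⟩ := Nat.exists_eq_add_of_le hj
      have hk' : q - 1 - (z.2.2 : ℕ) = k := by omega
      rw [hk', hk]
      have hr1 : ∃ r', r = r' + 1 := ⟨r - 1, by
        have : 0 < r := by positivity
        omega⟩
      obtain ⟨r', hr'⟩ := hr1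
      have e1 : (c z ^ r) ^ r = c z := by rw [← pow_mul, hfix]
      have e2 : (x ^ (r * (z.2.1 : ℕ))) ^ r = x ^ (z.2.1 : ℕ) := by
        rw [← pow_mul, mul_right_comm, pow_mul, hfix]
      simp only [mul_pow, e1, e2]
      have : r - 1 = r' := by omega
      rw [this, hr']
      ring
    rw [mul_zero] at hpow
    exact pow_eq_zero_iff (by positivity) |>.1 hpow
  calc Z.card ≤ H.roots.toFinset.card := by
        apply Finset.card_le_card
        intro x hx
        rw [Multiset.mem_toFinset, mem_roots hHne]
        exact hroot x hx
    _ ≤ Multiset.card H.roots := Multiset.toFinset_card_le _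
    _ ≤ H.natDegree := card_roots' H
    _ ≤ _ := hHdeg

end Stepanov
open Finset

section Stepanov2
open Polynomial

theorem trace_count {F L : Type} [Field F] [Fintype F] [Field L] [Fintype L] [DecidableEq L]
    [DecidableEq F] [Algebra F L]
    (k : ℕ) (hrank : Module.finrank F L = 2 * (k + 1)) (hodd : 3 ≤ Fintype.card F)
    (a b s : F) (ha : a ≠ 0) :
    (univ.filter fun x : L => x ≠ 0 ∧
      Algebra.trace F L (algebraMap F L a * x + algebraMap F L b * x⁻¹) = s).card ≤
      Fintype.card F ^ (k + 1) * Fintype.card F ^ k + 5 * Fintype.card F ^ (k + 1) := by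
  classical
  set q := Fintype.card F with hq
  obtain ⟨p, hp⟩ := CharP.exists F
  have := hp
  obtain ⟨n, hpp, hn⟩ := FiniteField.card F p
  have : Fact p.Prime := ⟨hpp⟩
  have : CharP L p := charP_of_injective_algebraMap (algebraMap F L).injective p
  set ρ := q ^ k with hρ
  have hqpos : 0 < q := by omega
  have hρpos : 0 < ρ := by positivity
  have hqρ : q * ρ = q ^ (k + 1) := by rw [hρ, pow_succ, mul_comm]
  set A := algebraMap F L a with hA
  set B := algebraMap F L b with hB
  have hA0 : A ≠ 0 := by simpa [hA] using ha
  let Tt : L[X] := ∑ i ∈ Finset.range (k + 1), (C A * X ^ (ρ + q ^ i) + C B * X ^ (ρ - q ^ i))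
  have hT : Tt.natDegree = 2 * ρ := by
    simp only [Tt]
    rw [Finset.sum_range_succ]
    have h2 : (C A * X ^ (ρ + q ^ k) + C B * X ^ (ρ - q ^ k) : L[X]).natDegree = 2 * ρ := by
      rw [natDegree_add_eq_left_of_natDegree_lt, natDegree_C_mul_X_pow _ _ hA0]
      · omega
      · rw [natDegree_C_mul_X_pow _ _ hA0]
        refine lt_of_le_of_lt (natDegree_C_mul_X_pow_le _ _) ?_
        omega
    rw [natDegree_add_eq_right_of_natDegree_lt, h2]
    rw [h2]
    refine lt_of_le_of_lt (natDegree_sum_le_of_forall_le (n := 2 * ρ - 1) _ _ ?_) (by omega)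
    intro i hi
    have hi' : q ^ i < ρ := Nat.pow_lt_pow_right (by omega) (Finset.mem_range.1 hi)
    refine (natDegree_add_le _ _).trans (max_le ?_ ?_)
    · exact (natDegree_C_mul_X_pow_le _ _).trans (by omega)
    · exact (natDegree_C_mul_X_pow_le _ _).trans (by omega)
  have hcard : Fintype.card L = (q * ρ) ^ 2 := by
    rw [Module.card_eq_pow_finrank (K := F) (V := L), hrank, hqρ, ← pow_mul, mul_comm (k+1)]
  have hpe : p ^ ((n : ℕ) * (k + 1)) = q * ρ := by
    rw [hqρ, pow_mul, ← hn]
  have key := stepanov_aux p ((n : ℕ) * (k + 1)) q ρ hpe hodd hρpos hcard Tt hT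
    (algebraMap F L s) (univ.filter fun x : L => x ≠ 0 ∧
      Algebra.trace F L (A * x + B * x⁻¹) = s) (by
        intro x hx
        exact (Finset.mem_filter.1 hx).2.1) (by
      intro x hx
      obtain ⟨hx0, hx⟩ := (Finset.mem_filter.1 hx).2
      have htr := congrArg (algebraMap F L) hx
      rw [FiniteField.algebraMap_trace_eq_sum_pow, hrank, Nat.card_eq_fintype_card, ← hq] at htr
      have hqi : ∀ i : ℕ, (q ^ i) = p ^ ((n : ℕ) * i) := by
        intro i; rw [pow_mul, ← hn]
      refine ⟨∑ i ∈ Finset.range (k + 1), (A * x + B * x⁻¹) ^ (q ^ i), ?_, ?_⟩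
      · simp only [Tt, eval_finsetSum, eval_add, eval_mul, eval_C, eval_pow, eval_X]
        rw [Finset.mul_sum]
        refine Finset.sum_congr rfl fun i hi => ?_
        have hi' : q ^ i ≤ ρ := Nat.pow_le_pow_right hqpos (by have := Finset.mem_range.1 hi; omega)
        have hAi : A ^ (q ^ i) = A := by
          rw [hA, ← map_pow, FiniteField.pow_card_pow]
        have hBi : B ^ (q ^ i) = B := by
          rw [hB, ← map_pow, FiniteField.pow_card_pow]
        have : (A * x + B * x⁻¹) ^ (q ^ i) = A * x ^ (q ^ i) + B * (x ^ (q ^ i))⁻¹ := by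
          conv_lhs => rw [hqi i, add_pow_expChar_pow, ← hqi i, mul_pow, mul_pow, hAi, hBi, inv_pow]
        rw [this, pow_add, pow_sub₀ _ hx0 hi']
        ring
      · rw [← htr, two_mul, Finset.sum_range_add _ (k + 1) (k + 1)]
        congr 1
        rw [← hpe, sum_pow_char_pow, hpe]
        refine Finset.sum_congr rfl fun i _ => ?_
        rw [← pow_mul, hqρ, ← pow_add, Nat.add_comm i])
  rw [hqρ] at key
  exact key

open Classical in
/-- Kloosterman sum. -/
noncomputable def klo {L : Type} [Field L] [Fintype L] (χ : AddChar L ℂ) (a b : L) : ℂ :=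
  ∑ x : Lˣ, χ (a * x + b * (x : L)⁻¹)

theorem klo_ext_bound {F L : Type} [Field F] [Fintype F] [Field L] [Fintype L] [Algebra F L]
    (k : ℕ) (hrank : Module.finrank F L = 2 * (k + 1)) (hodd : 3 ≤ Fintype.card F)
    (ψ : AddChar F ℂ) (hψ : ψ ≠ 1) (χ : AddChar L ℂ) (hχ : ∀ x, χ x = ψ (Algebra.trace F L x))
    (a b : F) (ha : a ≠ 0) :
    ‖klo χ (algebraMap F L a) (algebraMap F L b)‖ ≤
      (5 * Fintype.card F + 1) * Real.sqrt (Fintype.card L) := by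
  classical
  set q := Fintype.card F with hq
  let g : Lˣ → F := fun x =>
    Algebra.trace F L (algebraMap F L a * x + algebraMap F L b * (x : L)⁻¹)
  let N : F → ℕ := fun s => (univ.filter fun x : Lˣ => g x = s).card
  have hN : ∀ s, N s ≤ q ^ (k + 1) * q ^ k + 5 * q ^ (k + 1) := by
    intro s
    refine le_trans ?_ (trace_count (L := L) k hrank hodd a b s ha)
    refine Finset.card_le_card_of_injOn (fun x => (x : L)) ?_ ?_
    · intro x hx
      have := (Finset.mem_filter.1 hx).2
      simp only [coe_filter, mem_univ, true_and, Set.mem_ofPred_eq]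
      exact ⟨x.ne_zero, this⟩
    · intro x _ y _ h
      exact Units.ext h
  have hK : klo χ (algebraMap F L a) (algebraMap F L b) = ∑ s, (N s : ℂ) * ψ s := by
    unfold klo
    simp only [hχ]
    rw [← Finset.sum_fiberwise univ g]
    refine Finset.sum_congr rfl fun s _ => ?_
    rw [Finset.sum_congr rfl (g := fun _ => ψ s)]
    · simp [N]
    · intro x hx
      have := (Finset.mem_filter.1 hx).2
      rw [← this]
  have hsum : ∑ s, (N s : ℝ) = Fintype.card L - 1 := by
    have : ∑ s, N s = Fintype.card Lˣ := by
      simp only [N]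
      exact (Finset.card_eq_sum_card_fiberwise (f := g) (s := univ) (t := univ)
        (fun x _ => by simp)).symm
    rw [← Nat.cast_sum, this, Fintype.card_units]
    rw [Nat.cast_sub Fintype.card_pos]; simp
  have hcard : Fintype.card L = (q ^ (k + 1)) ^ 2 := by
    rw [Module.card_eq_pow_finrank (K := F) (V := L), hrank, ← pow_mul, mul_comm (k+1)]
  set M : ℝ := (q:ℝ) ^ (k + 1) * q ^ k + 5 * q ^ (k + 1) with hM
  have hN' : ∀ s, (N s : ℝ) ≤ M := by
    intro s
    have := hN s
    rw [hM]
    exact_mod_cast this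
  have hK2 : klo χ (algebraMap F L a) (algebraMap F L b) = ∑ s, ((N s : ℂ) - M) * ψ s := by
    rw [hK]
    simp only [sub_mul, Finset.sum_sub_distrib, ← Finset.mul_sum]
    rw [AddChar.sum_eq_zero_of_ne_one hψ]; simp
  rw [hK2]
  refine (norm_sum_le _ _).trans ?_
  have : ∀ s, ‖((N s : ℂ) - M) * ψ s‖ = M - N s := by
    intro s
    rw [norm_mul, AddChar.norm_apply, mul_one, norm_sub_rev]
    rw [← Complex.ofReal_natCast, ← Complex.ofReal_sub, Complex.norm_real, Real.norm_eq_abs,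
      abs_of_nonneg (sub_nonneg.2 (hN' s))]
  simp only [this, Finset.sum_sub_distrib, hsum]
  rw [hcard]
  push_cast
  rw [Real.sqrt_sq (by positivity)]
  simp only [Finset.sum_const, Finset.card_univ, ← hq, nsmul_eq_mul, hM]
  have h1 : (1:ℝ) ≤ (q:ℝ) ^ (k+1) := one_le_pow₀ (by exact_mod_cast (by omega : 1 ≤ q))
  have h2 : (q:ℝ) * ((q:ℝ) ^ (k + 1) * q ^ k) = ((q:ℝ)^(k+1))^2 := by ring
  nlinarith

end Stepanov2
open Finset

section Doubling

open Classical in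
theorem sum_units_eq {L : Type} [Field L] [Fintype L] (f : L → ℂ) :
    ∑ x : Lˣ, f x = ∑ x : L, if x = 0 then 0 else f x := by
  rw [← Finset.sum_filter_add_sum_filter_not univ (fun x : L => x = 0)]
  rw [Finset.sum_eq_zero (s := univ.filter (fun x : L => x = 0)), zero_add]
  · symm
    refine Finset.sum_bij' (fun x hx => Units.mk0 x (Finset.mem_filter.1 hx).2) (fun x _ => (x : L))
      ?_ ?_ ?_ ?_ ?_
    · intros; simp
    · intro x _; simp
    · intros; simp
    · intros; simp
    · intro x hx
      have := (Finset.mem_filter.1 hx).2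
      simp [this]
  · intro x hx
    have := (Finset.mem_filter.1 hx).2
    simp [this]

open Classical in
theorem quad_count {L L' : Type} [Field L] [Fintype L] [Field L'] [Fintype L'] [Algebra L L']
    (hrank : Module.finrank L L' = 2) (T N : L) :
    (univ.filter fun x : L' => Algebra.trace L L' x = T ∧ Algebra.norm L x = N).card +
    (univ.filter fun x : L × L => x.1 + x.2 = T ∧ x.1 * x.2 = N).card = 2 := by
  set Q := Fintype.card L with hQ
  let i := algebraMap L L'
  have hi : Function.Injective i := (algebraMap L L').injective
  have htr : ∀ x : L', i (Algebra.trace L L' x) = x + x ^ Q := by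
    intro x
    simp only [i]
    rw [FiniteField.algebraMap_trace_eq_sum_pow, hrank, Nat.card_eq_fintype_card, ← hQ]
    simp [Finset.sum_range_succ]
  have hnm : ∀ x : L', i (Algebra.norm L x) = x * x ^ Q := by
    intro x
    simp only [i]
    rw [FiniteField.algebraMap_norm_eq_prod_pow, hrank, Nat.card_eq_fintype_card, ← hQ]
    simp [Finset.prod_range_succ]
  have hfix : ∀ r : L, (i r) ^ Q = i r := by
    intro r
    rw [← map_pow, FiniteField.pow_card]
  have hle : ∀ z : L × L,
      (univ.filter fun x : L' => Algebra.trace L L' x = z.1 ∧ Algebra.norm L x = z.2).card +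
      (univ.filter fun x : L × L => x.1 + x.2 = z.1 ∧ x.1 * x.2 = z.2).card ≤ 2 := by
    rintro ⟨T, N⟩
    simp only
    by_cases hr : ∃ r : L, r * (T - r) = N
    · obtain ⟨r, hr⟩ := hr
      have hP : (univ.filter fun x : L × L => x.1 + x.2 = T ∧ x.1 * x.2 = N) ⊆
          {(r, T - r), (T - r, r)} := by
        rintro ⟨x, y⟩ hx
        obtain ⟨h1, h2⟩ := (Finset.mem_filter.1 hx).2
        simp only at h1 h2
        have hy : y = T - x := by rw [← h1]; ring
        subst hy
        have : (x - r) * (x - (T - r)) = 0 := by linear_combination hr - h2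
        rcases mul_eq_zero.1 this with h | h
        · have : x = r := sub_eq_zero.1 h
          simp [this]
        · have : x = T - r := sub_eq_zero.1 h
          simp [this]
      have hE : ∀ x ∈ (univ.filter fun x : L' => Algebra.trace L L' x = T ∧ Algebra.norm L x = N),
          x = i r ∧ T - r = r := by
        intro x hx
        obtain ⟨h1, h2⟩ := (Finset.mem_filter.1 hx).2
        have h1' := htr x
        have h2' := hnm x
        rw [h1] at h1'
        rw [h2, ← hr, map_mul, map_sub] at h2'
        have : (x - i r) * (x - i (T - r)) = 0 := by
          rw [map_sub]
          linear_combination h2' - x * h1'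
        rcases mul_eq_zero.1 this with h | h
        · have hx : x = i r := sub_eq_zero.1 h
          rw [hx, hfix, ← map_add] at h1'
          have := hi h1'
          exact ⟨hx, by rw [this]; ring⟩
        · have hx : x = i (T - r) := sub_eq_zero.1 h
          rw [hx, hfix, ← map_add] at h1'
          have := hi h1'
          have h3 : T - r = r := by linear_combination -this
          exact ⟨by rw [hx, h3], h3⟩
      by_cases hTr : T - r = r
      · rw [hTr] at hP
        have c1 : (univ.filter fun x : L × L => x.1 + x.2 = T ∧ x.1 * x.2 = N).card ≤ 1 := by
          refine (Finset.card_le_card hP).trans (by simp)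
        have c2 : (univ.filter fun x : L' => Algebra.trace L L' x = T ∧ Algebra.norm L x = N).card ≤ 1 := by
          refine (Finset.card_le_card (t := {i r}) ?_).trans (by simp)
          intro x hx
          simp [(hE x hx).1]
        omega
      · have c1 : (univ.filter fun x : L × L => x.1 + x.2 = T ∧ x.1 * x.2 = N).card ≤ 2 :=
          (Finset.card_le_card hP).trans Finset.card_le_two
        have c2 : (univ.filter fun x : L' => Algebra.trace L L' x = T ∧ Algebra.norm L x = N) = ∅ := by
          rw [Finset.eq_empty_iff_forall_notMem]
          intro x hx
          exact hTr (hE x hx).2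
        rw [c2]
        simpa using c1
    · have c1 : (univ.filter fun x : L × L => x.1 + x.2 = T ∧ x.1 * x.2 = N) = ∅ := by
        rw [Finset.eq_empty_iff_forall_notMem]
        rintro ⟨x, y⟩ hx
        obtain ⟨h1, h2⟩ := (Finset.mem_filter.1 hx).2
        simp only at h1 h2
        exact hr ⟨x, by rw [← h1, ← h2]; ring⟩
      rw [c1]
      simp only [Finset.card_empty, add_zero]
      rcases Finset.eq_empty_or_nonempty
        (univ.filter fun x : L' => Algebra.trace L L' x = T ∧ Algebra.norm L x = N) with h | ⟨x0, hx0⟩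
      · rw [h]; simp
      · refine (Finset.card_le_card (t := {x0, i T - x0}) ?_).trans Finset.card_le_two
        intro x hx
        obtain ⟨h1, h2⟩ := (Finset.mem_filter.1 hx).2
        obtain ⟨h3, h4⟩ := (Finset.mem_filter.1 hx0).2
        have h1' := htr x
        have h2' := hnm x
        have h3' := htr x0
        have h4' := hnm x0
        rw [h1] at h1'
        rw [h2] at h2'
        rw [h3] at h3'
        rw [h4] at h4'
        have : (x - x0) * (x - (i T - x0)) = 0 := by
          linear_combination h2' - x * h1' - h4' + x0 * h3'
        rcases mul_eq_zero.1 this with h | h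
        · simp [sub_eq_zero.1 h]
        · simp [sub_eq_zero.1 h]
  have hsum : ∑ z : L × L,
      ((univ.filter fun x : L' => Algebra.trace L L' x = z.1 ∧ Algebra.norm L x = z.2).card +
      (univ.filter fun x : L × L => x.1 + x.2 = z.1 ∧ x.1 * x.2 = z.2).card) = ∑ z : L × L, 2 := by
    rw [Finset.sum_add_distrib]
    have s1 := Finset.card_eq_sum_card_fiberwise
      (f := fun x : L' => (Algebra.trace L L' x, Algebra.norm L x))
      (s := univ) (t := univ) (fun x _ => by simp)
    have s2 := Finset.card_eq_sum_card_fiberwise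
      (f := fun x : L × L => (x.1 + x.2, x.1 * x.2))
      (s := univ) (t := univ) (fun x _ => by simp)
    simp only [Prod.ext_iff] at s1 s2
    rw [← s1, ← s2]
    have : Fintype.card L' = Q ^ 2 := by
      rw [Module.card_eq_pow_finrank (K := L) (V := L'), hrank]
    simp [Finset.card_univ, this, ← hQ]
    ring
  exact (Finset.sum_eq_sum_iff_of_le (fun z _ => hle z)).1 hsum (T, N) (mem_univ _)

open Classical in
theorem klo_double {L L' : Type} [Field L] [Fintype L] [Field L'] [Fintype L'] [Algebra L L']
    (hrank : Module.finrank L L' = 2) (χ : AddChar L ℂ) (hχ : χ ≠ 1) (χ' : AddChar L' ℂ)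
    (hχ' : ∀ x, χ' x = χ (Algebra.trace L L' x)) (a b : L) (ha : a ≠ 0) (hb : b ≠ 0) :
    klo χ' (algebraMap L L' a) (algebraMap L L' b) + klo χ a b ^ 2 = 2 * Fintype.card L := by
  set Q := Fintype.card L with hQ
  let φ : L × L → ℂ := fun z => if z.2 = 0 then 0 else χ (a * z.1 + b * (z.1 * z.2⁻¹))
  have hK' : klo χ' (algebraMap L L' a) (algebraMap L L' b) =
      ∑ x : L', φ (Algebra.trace L L' x, Algebra.norm L x) := by
    unfold klo
    rw [sum_units_eq (fun x : L' => χ' (algebraMap L L' a * x + algebraMap L L' b * x⁻¹))]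
    refine Finset.sum_congr rfl fun x _ => ?_
    simp only [φ]
    have hN0 : Algebra.norm L x = 0 ↔ x = 0 := Algebra.norm_eq_zero_iff
    by_cases hx : x = 0
    · simp [hx]
    · rw [if_neg hx, if_neg (by rwa [hN0]), hχ']
      congr 1
      rw [map_add, ← Algebra.smul_def, ← Algebra.smul_def, map_smul, map_smul, smul_eq_mul, smul_eq_mul]
      congr 2
      have hN : Algebra.norm L x ≠ 0 := by rwa [Ne, hN0]
      have htr : ∀ x : L', algebraMap L L' (Algebra.trace L L' x) = x + x ^ Q := by
        intro x
        rw [FiniteField.algebraMap_trace_eq_sum_pow, hrank, Nat.card_eq_fintype_card, ← hQ]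
        simp [Finset.sum_range_succ]
      have hnm : ∀ x : L', algebraMap L L' (Algebra.norm L x) = x * x ^ Q := by
        intro x
        rw [FiniteField.algebraMap_norm_eq_prod_pow, hrank, Nat.card_eq_fintype_card, ← hQ]
        simp [Finset.prod_range_succ]
      apply (algebraMap L L').injective
      rw [htr, map_mul, htr, map_inv₀ (algebraMap L L'), hnm]
      have : x ^ Q ≠ 0 := pow_ne_zero _ hx
      rw [inv_pow]
      field_simp
      ring
  have hK : klo χ a b ^ 2 = ∑ x : L × L, φ (x.1 + x.2, x.1 * x.2) := by
    unfold klo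
    rw [sum_units_eq (fun x : L => χ (a * x + b * x⁻¹)), sq, Finset.sum_mul_sum,
      ← Finset.univ_product_univ, Finset.sum_product]
    refine Finset.sum_congr rfl fun x _ => Finset.sum_congr rfl fun y _ => ?_
    simp only [φ]
    by_cases hx : x = 0
    · simp [hx]
    by_cases hy : y = 0
    · simp [hy]
    rw [if_neg hx, if_neg hy, if_neg (mul_ne_zero hx hy), ← AddChar.map_add_eq_mul]
    congr 1
    field_simp
    ring
  have f1 : ∑ x : L', φ (Algebra.trace L L' x, Algebra.norm L x) = ∑ z : L × L,
      ((univ.filter fun x : L' => Algebra.trace L L' x = z.1 ∧ Algebra.norm L x = z.2).card : ℂ) * φ z := by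
    rw [← Finset.sum_fiberwise univ (fun x : L' => (Algebra.trace L L' x, Algebra.norm L x))]
    refine Finset.sum_congr rfl fun z _ => ?_
    rw [Finset.sum_congr rfl (g := fun _ => φ z)]
    · simp [Prod.ext_iff]
    · intro x hx
      rw [(Finset.mem_filter.1 hx).2]
  have f2 : ∑ x : L × L, φ (x.1 + x.2, x.1 * x.2) = ∑ z : L × L,
      ((univ.filter fun x : L × L => x.1 + x.2 = z.1 ∧ x.1 * x.2 = z.2).card : ℂ) * φ z := by
    rw [← Finset.sum_fiberwise univ (fun x : L × L => (x.1 + x.2, x.1 * x.2))]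
    refine Finset.sum_congr rfl fun z _ => ?_
    rw [Finset.sum_congr rfl (g := fun _ => φ z)]
    · simp [Prod.ext_iff]
    · intro x hx
      rw [(Finset.mem_filter.1 hx).2]
  rw [hK', hK, f1, f2, ← Finset.sum_add_distrib]
  have : ∀ z : L × L, ((univ.filter fun x : L' => Algebra.trace L L' x = z.1 ∧ Algebra.norm L x = z.2).card : ℂ) * φ z
      + ((univ.filter fun x : L × L => x.1 + x.2 = z.1 ∧ x.1 * x.2 = z.2).card : ℂ) * φ z = 2 * φ z := by
    intro z
    rw [← add_mul]
    congr 1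
    exact_mod_cast quad_count hrank z.1 z.2
  rw [Finset.sum_congr rfl (fun z _ => this z), ← Finset.mul_sum]
  congr 1
  rw [← Finset.univ_product_univ, Finset.sum_product_right]
  have hprim : χ.IsPrimitive := AddChar.IsPrimitive.of_ne_one hχ
  have : ∀ N : L, ∑ T : L, φ (T, N) = if N = -b / a then (Q : ℂ) else 0 := by
    intro N
    simp only [φ]
    by_cases hN : N = 0
    · have : N ≠ -b / a := by
        rw [hN]
        exact (div_ne_zero (neg_ne_zero.2 hb) ha).symm
      rw [if_neg this]
      simp [hN]
    · simp only [if_neg hN]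
      have e : ∀ T : L, a * T + b * (T * N⁻¹) = T * (a + b * N⁻¹) := by intro T; ring
      simp only [e]
      rw [AddChar.sum_mulShift _ hprim]
      have : a + b * N⁻¹ = 0 ↔ N = -b / a := by
        rw [eq_div_iff ha]
        constructor
        · intro h
          field_simp at h
          linear_combination h
        · intro h
          field_simp
          linear_combination h
      simp only [this]
      split_ifs <;> simp [hQ]
  simp only [this]
  simp

end Doubling
open Finset

section Weil

theorem klo_tower {F : Type} [Field F] [Fintype F]
    (ψ : AddChar F ℂ) (hψ : ψ ≠ 1) (a b : F) (ha : a ≠ 0) (hb : b ≠ 0) (e : ℝ) (he : 0 ≤ e)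
    (h0 : (2 + e) * Real.sqrt (Fintype.card F) ≤ ‖klo ψ a b‖) (j : ℕ) :
    ∃ (L : Type) (_ : Field L) (_ : Fintype L) (_ : Algebra F L) (χ : AddChar L ℂ),
      (∀ x, χ x = ψ (Algebra.trace F L x)) ∧ Module.finrank F L = 2 ^ j ∧
      (2 + 4 ^ j * e) * Real.sqrt (Fintype.card L) ≤
        ‖klo χ (algebraMap F L a) (algebraMap F L b)‖ := by
  induction j with
  | zero =>
    refine ⟨F, inferInstance, inferInstance, inferInstance, ψ, ?_, ?_, ?_⟩
    · intro x; rw [Algebra.trace_self_apply]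
    · simp
    · simpa using h0
  | succ j ih =>
    obtain ⟨L, iL, fL, aL, χ, hχ, hrank, hb'⟩ := ih
    obtain ⟨p, hp⟩ := CharP.exists L
    have hpp : Fact p.Prime := ⟨(FiniteField.card L p).choose_spec.1⟩
    let L' := FiniteField.Extension L p 2
    let : Fintype L' := Fintype.ofFinite L'
    let : Algebra F L' := ((algebraMap L L').comp (algebraMap F L)).toAlgebra
    have : IsScalarTower F L L' := IsScalarTower.of_algebraMap_eq (fun x => rfl)
    have hr2 : Module.finrank L L' = 2 := FiniteField.finrank_extension L p 2
    let χ' : AddChar L' ℂ := ψ.compAddMonoidHom (Algebra.trace F L').toAddMonoidHom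
    have hχ' : ∀ x, χ' x = ψ (Algebra.trace F L' x) := fun x => rfl
    refine ⟨L', inferInstance, inferInstance, inferInstance, χ', hχ', ?_, ?_⟩
    · rw [← Module.finrank_mul_finrank F L L', hrank, hr2, pow_succ]
    · have hχ1 : χ ≠ 1 := by
        intro h
        apply hψ
        ext y
        obtain ⟨x, rfl⟩ := Algebra.trace_surjective F L y
        rw [← hχ, h]; simp
      have hd := klo_double (L' := L') hr2 χ hχ1 χ' (by
        intro x
        rw [hχ', hχ, Algebra.trace_trace]) (algebraMap F L a) (algebraMap F L b)
        (by simpa using ha) (by simpa using hb)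
      have hc : (Fintype.card L' : ℝ) = (Fintype.card L : ℝ) ^ 2 := by
        rw [Module.card_eq_pow_finrank (K := L) (V := L'), hr2]; push_cast; rfl
      rw [hc, Real.sqrt_sq (by positivity)]
      rw [IsScalarTower.algebraMap_apply F L L' a, IsScalarTower.algebraMap_apply F L L' b]
      set K := klo χ (algebraMap F L a) (algebraMap F L b)
      set K' := klo χ' (algebraMap L L' (algebraMap F L a)) (algebraMap L L' (algebraMap F L b))
      have h1 : ‖K‖ ^ 2 ≤ 2 * Fintype.card L + ‖K'‖ := by
        have : K ^ 2 = 2 * Fintype.card L - K' := by rw [← hd]; ring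
        rw [← norm_pow, this]
        refine (norm_sub_le _ _).trans ?_
        simp
      have h2 : ((2 + 4 ^ j * e) * Real.sqrt (Fintype.card L)) ^ 2 ≤ ‖K‖ ^ 2 := by
        gcongr
      rw [mul_pow, Real.sq_sqrt (by positivity)] at h2
      have h3 : (2 + 4 ^ (j + 1) * e) ≤ (2 + 4 ^ j * e) ^ 2 - 2 := by
        rw [pow_succ]; nlinarith [sq_nonneg ((4:ℝ) ^ j * e)]
      have h4 : (2 + 4 ^ (j + 1) * e) * (Fintype.card L : ℝ) ≤
          ((2 + 4 ^ j * e) ^ 2 - 2) * (Fintype.card L : ℝ) := by gcongr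
      linarith

theorem klo_bound {F : Type} [Field F] [Fintype F] (hodd : 3 ≤ Fintype.card F)
    (ψ : AddChar F ℂ) (hψ : ψ ≠ 1) (a b : F) (ha : a ≠ 0) (hb : b ≠ 0) :
    ‖klo ψ a b‖ ≤ 2 * Real.sqrt (Fintype.card F) := by
  by_contra! hlt
  have hs : 0 < Real.sqrt (Fintype.card F) := Real.sqrt_pos.2 (by exact_mod_cast (by omega))
  set e : ℝ := ‖klo ψ a b‖ / Real.sqrt (Fintype.card F) - 2 with he
  have he0 : 0 < e := by
    rw [he, sub_pos, lt_div_iff₀ hs]; exact hlt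
  have h0 : (2 + e) * Real.sqrt (Fintype.card F) ≤ ‖klo ψ a b‖ := by
    rw [he, add_sub_cancel, div_mul_cancel₀ _ hs.ne']
  obtain ⟨j, hj⟩ := pow_unbounded_of_one_lt ((5 * Fintype.card F + 1) / e) (by norm_num : (1:ℝ) < 4)
  obtain ⟨L, iL, fL, aL, χ, hχ, hrank, hb'⟩ := klo_tower ψ hψ a b ha hb e he0.le h0 (j + 1)
  have hpos : 0 < 2 ^ j := by positivity
  have hub := klo_ext_bound (2 ^ j - 1) (by rw [hrank, pow_succ]; omega) hodd ψ hψ χ hχ a b ha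
  have hL : 0 < Real.sqrt (Fintype.card L) := Real.sqrt_pos.2 (by exact_mod_cast Fintype.card_pos)
  have := le_of_mul_le_mul_right (hb'.trans hub) hL
  rw [div_lt_iff₀ he0] at hj
  have h5 : (4:ℝ) ^ (j + 1) * e = 4 * (4 ^ j * e) := by ring
  have h6 : 0 < (4:ℝ) ^ j * e := by positivity
  linarith

end Weil
open Finset

section Salie

open Classical in
/-- quadratic character with complex values -/
noncomputable def etaC (F : Type) [Field F] [Fintype F] : MulChar F ℂ :=
  (quadraticChar F).ringHomComp (Int.castRingHom ℂ)

open Classical in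
theorem etaC_apply {F : Type} [Field F] [Fintype F] (x : F) :
    etaC F x = ((quadraticChar F x : ℤ) : ℂ) := rfl

/-- Salie sum -/
noncomputable def sal {F : Type} [Field F] [Fintype F] (ψ : AddChar F ℂ) (a b : F) : ℂ :=
  ∑ x : F, etaC F x * ψ (a * x + b * x⁻¹)

theorem etaC_ne_one {F : Type} [Field F] [Fintype F] (h2 : ringChar F ≠ 2) : etaC F ≠ 1 := by
  classical
  intro h
  obtain ⟨a, ha⟩ := quadraticChar_exists_neg_one' h2
  have h1 : etaC F a = 1 := by rw [h, MulChar.one_apply_coe]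
  rw [etaC_apply, ha] at h1
  norm_num at h1

theorem gauss_norm {F : Type} [Field F] [Fintype F] (h2 : ringChar F ≠ 2)
    (ψ : AddChar F ℂ) (hψ : ψ ≠ 1) (c : F) (hc : c ≠ 0) :
    ‖∑ x : F, etaC F x * ψ (c * x)‖ = Real.sqrt (Fintype.card F) := by
  have hprim : ψ.IsPrimitive := AddChar.IsPrimitive.of_ne_one hψ
  have hps : AddChar.IsPrimitive (ψ.mulShift c) := AddChar.IsPrimitive.of_ne_one (hprim hc)
  have h1 := gaussSum_mul_gaussSum_eq_card (etaC_ne_one h2) hps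
  rw [← star_gaussSum_eq] at h1
  have : gaussSum (etaC F) (ψ.mulShift c) = ∑ x : F, etaC F x * ψ (c * x) := by
    simp [gaussSum, AddChar.mulShift_apply]
  rw [this] at h1
  have h3 : ‖∑ x : F, etaC F x * ψ (c * x)‖ ^ 2 = Fintype.card F := by
    have := congrArg norm h1
    rw [norm_mul, norm_star] at this
    rw [sq, this]; simp
  rw [← h3, Real.sqrt_sq (norm_nonneg _)]

theorem etaC_sq {F : Type} [Field F] [Fintype F] {x : F} (hx : x ≠ 0) : etaC F x * etaC F x = 1 := by
  classical
  rw [etaC_apply, ← Int.cast_mul, ← sq, quadraticChar_sq_one hx]; simp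

open Classical in
theorem etaC_fiber {F : Type} [Field F] [Fintype F] (h2 : ringChar F ≠ 2) (e v : F) (he : e ≠ 0) :
    ∑ x ∈ univ.filter (fun x : F => (x - e) ^ 2 * x⁻¹ = v), etaC F x =
      etaC F v + etaC F (v + 4 * e) := by
  classical
  have two : (2 : F) ≠ 0 := Ring.two_ne_zero h2
  have h4 : etaC F (4 * e) = etaC F e := by
    have : (4 : F) = 2 * 2 := by norm_num
    rw [this, map_mul, map_mul, etaC_sq two, one_mul]
  have h00 : etaC F 0 = 0 := MulChar.map_zero _
  by_cases hv : v = 0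
  · subst hv
    rw [zero_add, h4, h00, zero_add]
    have : (univ.filter (fun x : F => (x - e) ^ 2 * x⁻¹ = 0)) = {e, 0} := by
      ext x
      simp only [mem_filter, mem_univ, true_and, mem_insert, mem_singleton, mul_eq_zero,
        inv_eq_zero, pow_eq_zero_iff two_ne_zero, sub_eq_zero]
    rw [this, Finset.sum_pair he, h00, add_zero]
  · have hx : ∀ x ∈ univ.filter (fun x : F => (x - e) ^ 2 * x⁻¹ = v),
        etaC F x = etaC F v := by
      intro x hx
      have hx := (Finset.mem_filter.1 hx).2
      have hx0 : x ≠ 0 := by rintro rfl; simp at hx; exact hv hx.symm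
      have hxe : x - e ≠ 0 := by
        intro h; rw [h] at hx; simp at hx; exact hv hx.symm
      have : v * x = (x - e) * (x - e) := by rw [← hx]; field_simp
      have h3 := congrArg (etaC F) this
      rw [map_mul, map_mul, etaC_sq hxe] at h3
      calc etaC F x = (etaC F v * etaC F x) * etaC F v * (1) := by
            rw [mul_one, mul_comm (etaC F v), mul_assoc, etaC_sq hv, mul_one]
        _ = _ := by rw [h3]; ring
    rw [Finset.sum_congr rfl hx, Finset.sum_const, nsmul_eq_mul]
    have hcard : (univ.filter (fun x : F => (x - e) ^ 2 * x⁻¹ = v)).card =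
        ({x : F | x ^ 2 = v * (v + 4 * e)}.toFinset).card := by
      refine Finset.card_bij' (fun x _ => 2 * x - (2 * e + v)) (fun y _ => (y + (2 * e + v)) / 2) ?_ ?_ ?_ ?_
      · intro x hx
        have hx := (Finset.mem_filter.1 hx).2
        have hx0 : x ≠ 0 := by rintro rfl; simp at hx; exact hv hx.symm
        have : v * x = (x - e) ^ 2 := by rw [← hx]; field_simp
        simp only [Set.mem_toFinset, Set.mem_ofPred_eq]
        linear_combination (-4) * this
      · intro y hy
        simp only [Set.mem_toFinset, Set.mem_ofPred_eq] at hy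
        simp only [mem_filter, mem_univ, true_and]
        set x := (y + (2 * e + v)) / 2 with hxdef
        have hy2 : y = 2 * x - (2 * e + v) := by rw [hxdef]; field_simp; ring
        rw [hy2] at hy
        have four : (4 : F) ≠ 0 := by
          have : (4 : F) = 2 * 2 := by norm_num
          rw [this]; exact mul_ne_zero two two
        have hm : 4 * ((x - e) ^ 2 - v * x) = 0 := by linear_combination hy
        have hm' : (x - e) ^ 2 = v * x := by
          rcases mul_eq_zero.1 hm with h | h
          · exact absurd h four
          · exact sub_eq_zero.1 h
        have hx0 : x ≠ 0 := by
          intro h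
          rw [h] at hm'
          simp at hm'
          exact he hm'
        rw [hm']; field_simp
      · intro x _; field_simp; ring
      · intro x _; field_simp; ring
    have hq := quadraticChar_card_sqrts h2 (v * (v + 4 * e))
    rw [hcard]
    have hq' : (({x : F | x ^ 2 = v * (v + 4 * e)}.toFinset).card : ℂ) =
        etaC F (v * (v + 4 * e)) + 1 := by
      rw [etaC_apply]
      exact_mod_cast congrArg (Int.cast : ℤ → ℂ) hq
    rw [hq', map_mul]
    linear_combination etaC F (v + 4 * e) * etaC_sq hv

theorem sal_bound {F : Type} [Field F] [Fintype F] (h2 : ringChar F ≠ 2)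
    (ψ : AddChar F ℂ) (hψ : ψ ≠ 1) (a b : F) (ha : a ≠ 0) :
    ‖sal ψ a b‖ ≤ 2 * Real.sqrt (Fintype.card F) := by
  classical
  have hs := Real.sqrt_nonneg (Fintype.card F : ℝ)
  have h00 : etaC F 0 = 0 := MulChar.map_zero _
  by_cases hb : b = 0
  · subst hb
    have := gauss_norm h2 ψ hψ a ha
    simp only [sal, zero_mul, add_zero]
    rw [this]; linarith
  by_cases hsq : IsSquare (b / a)
  · obtain ⟨e, hee⟩ := hsq
    have he : e ≠ 0 := by
      rintro rfl
      simp at hee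
      tauto
    have hbe : b = a * (e * e) := by rw [← hee]; field_simp
    have h1 : sal ψ a b = ψ (2 * a * e) * ∑ x : F, etaC F x * ψ (a * ((x - e) ^ 2 * x⁻¹)) := by
      unfold sal
      rw [Finset.mul_sum]
      refine Finset.sum_congr rfl fun x _ => ?_
      by_cases hx : x = 0
      · simp [hx, h00]
      · have : a * x + b * x⁻¹ = 2 * a * e + a * ((x - e) ^ 2 * x⁻¹) := by
          rw [hbe]; field_simp; ring
        rw [this, AddChar.map_add_eq_mul]; ring
    have h3 : ∑ x : F, etaC F x * ψ (a * ((x - e) ^ 2 * x⁻¹)) =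
        ∑ v : F, (etaC F v + etaC F (v + 4 * e)) * ψ (a * v) := by
      rw [← Finset.sum_fiberwise univ (fun x : F => (x - e) ^ 2 * x⁻¹)]
      refine Finset.sum_congr rfl fun v _ => ?_
      rw [← etaC_fiber h2 e v he, Finset.sum_mul]
      refine Finset.sum_congr rfl fun x hx => ?_
      rw [(Finset.mem_filter.1 hx).2]
    have h4 : ∑ v : F, etaC F (v + 4 * e) * ψ (a * v) =
        ψ (-(4 * a * e)) * ∑ v : F, etaC F v * ψ (a * v) := by
      rw [← Equiv.sum_comp (Equiv.addRight (4 * e)) (fun v => etaC F v * ψ (a * v)), Finset.mul_sum]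
      refine Finset.sum_congr rfl fun v _ => ?_
      simp only [Equiv.coe_addRight]
      have : a * v = -(4 * a * e) + a * (v + 4 * e) := by ring
      rw [this, AddChar.map_add_eq_mul]
      ring
    rw [h1, h3]
    simp only [add_mul, Finset.sum_add_distrib]
    rw [h4, norm_mul, AddChar.norm_apply, one_mul]
    refine (norm_add_le _ _).trans ?_
    rw [norm_mul, AddChar.norm_apply, one_mul, gauss_norm h2 ψ hψ a ha]
    linarith
  · have hba : b / a ≠ 0 := div_ne_zero hb ha
    have hη : etaC F (b / a) = -1 := by
      rw [etaC_apply, quadraticChar_neg_one_iff_not_isSquare.2 hsq]; simp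
    have h1 : sal ψ a b = - sal ψ a b := by
      conv_lhs => unfold sal
      have hinv : Function.Involutive (fun x : F => (b / a) * x⁻¹) := by
        intro x
        by_cases hx : x = 0
        · simp [hx]
        · simp only; field_simp
      rw [← Equiv.sum_comp hinv.toPerm]
      unfold sal
      rw [← Finset.sum_neg_distrib]
      refine Finset.sum_congr rfl fun x _ => ?_
      simp only [Function.Involutive.coe_toPerm]
      by_cases hx : x = 0
      · simp [hx, h00]
      have e1 : etaC F (b / a * x⁻¹) = - etaC F x := by
        rw [map_mul, hη]
        have h5 := etaC_sq hx
        have h6 : etaC F x * etaC F x⁻¹ = 1 := by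
          rw [← map_mul, mul_inv_cancel₀ hx, map_one]
        have h7 : etaC F x⁻¹ = etaC F x := by
          linear_combination etaC F x * h6 - etaC F x⁻¹ * h5
        rw [h7]; ring
      have e2 : a * (b / a * x⁻¹) + b * (b / a * x⁻¹)⁻¹ = a * x + b * x⁻¹ := by
        field_simp; ring
      rw [e1, e2]; ring
    have : sal ψ a b = 0 := by
      have : (2 : ℂ) * sal ψ a b = 0 := by linear_combination h1
      simpa using this
    rw [this]; simp

end Salie
open Finset

section Spectral

variable {F : Type} [Field F] [Fintype F] {d : ℕ}

/-- the pairing character -/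
noncomputable def eB (ψ : AddChar F ℂ) (Q : QuadraticForm F (Fin d → F)) (ξ : Fin d → F) :
    AddChar (Fin d → F) ℂ :=
  ψ.compAddMonoidHom (Q.polarBilin ξ).toAddMonoidHom

theorem eB_apply (ψ : AddChar F ℂ) (Q : QuadraticForm F (Fin d → F)) (ξ x : Fin d → F) :
    eB ψ Q ξ x = ψ (QuadraticMap.polar Q ξ x) := rfl

theorem eB_comm (ψ : AddChar F ℂ) (Q : QuadraticForm F (Fin d → F)) (ξ x : Fin d → F) :
    eB ψ Q ξ x = eB ψ Q x ξ := by
  rw [eB_apply, eB_apply, QuadraticMap.polar_comm]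

theorem eB_norm (ψ : AddChar F ℂ) (Q : QuadraticForm F (Fin d → F)) (ξ x : Fin d → F) :
    ‖eB ψ Q ξ x‖ = 1 := AddChar.norm_apply _ _

open Classical in
theorem eB_sum (ψ : AddChar F ℂ) (hψ : ψ ≠ 1) (Q : QuadraticForm F (Fin d → F))
    (hQ : ∀ x, (∀ y, QuadraticMap.polar (⇑Q) x y = 0) → x = 0) (u : Fin d → F) :
    ∑ y, eB ψ Q u y = if u = 0 then (Fintype.card (Fin d → F) : ℂ) else 0 := by
  split_ifs with hu
  · subst hu
    simp [eB_apply]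
  · apply AddChar.sum_eq_zero_of_ne_one
    intro h
    apply hu
    apply hQ
    intro y
    by_contra hy
    apply hψ
    ext t
    have := DFunLike.congr_fun h ((t / QuadraticMap.polar Q u y) • y)
    rw [eB_apply, QuadraticMap.polar_smul_right, smul_eq_mul, div_mul_cancel₀ _ hy] at this
    simpa using this

/-- Fourier transform -/
noncomputable def ft (ψ : AddChar F ℂ) (Q : QuadraticForm F (Fin d → F)) (f : (Fin d → F) → ℂ)
    (ξ : Fin d → F) : ℂ := ∑ x, f x * eB ψ Q ξ x

theorem eB_conj (ψ : AddChar F ℂ) (Q : QuadraticForm F (Fin d → F)) (ξ x : Fin d → F) :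
    (starRingEnd ℂ) (eB ψ Q ξ x) = eB ψ Q ξ (-x) := (AddChar.map_neg_eq_conj _ _).symm

theorem ft_parseval (ψ : AddChar F ℂ) (hψ : ψ ≠ 1) (Q : QuadraticForm F (Fin d → F))
    (hQ : ∀ x, (∀ y, QuadraticMap.polar (⇑Q) x y = 0) → x = 0) (f : (Fin d → F) → ℝ) :
    ∑ ξ, ‖ft ψ Q (fun x => (f x : ℂ)) ξ‖ ^ 2 = Fintype.card (Fin d → F) * ∑ x, f x ^ 2 := by
  classical
  have h : ∀ ξ, ((‖ft ψ Q (fun x => (f x : ℂ)) ξ‖ ^ 2 : ℝ) : ℂ) =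
      ∑ x, ∑ y, (f x : ℂ) * f y * eB ψ Q (x - y) ξ := by
    intro ξ
    rw [Complex.ofReal_pow, ← Complex.mul_conj']
    unfold ft
    rw [map_sum, Finset.sum_mul_sum]
    refine Finset.sum_congr rfl fun x _ => Finset.sum_congr rfl fun y _ => ?_
    rw [map_mul, eB_conj, Complex.conj_ofReal, eB_comm _ _ (x - y), sub_eq_add_neg, AddChar.map_add_eq_mul]
    ring
  have h2 : ((∑ ξ, ‖ft ψ Q (fun x => (f x : ℂ)) ξ‖ ^ 2 : ℝ) : ℂ) =
      ((Fintype.card (Fin d → F) * ∑ x, f x ^ 2 : ℝ) : ℂ) := by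
    rw [Complex.ofReal_sum]
    simp only [h]
    rw [Finset.sum_comm]
    simp only [Complex.ofReal_mul, Complex.ofReal_sum, Complex.ofReal_natCast, Finset.mul_sum]
    refine Finset.sum_congr rfl fun x _ => ?_
    rw [Finset.sum_comm]
    simp only [← Finset.mul_sum, eB_sum ψ hψ Q hQ, sub_eq_zero]
    simp
    ring
  exact_mod_cast h2

theorem conv_bound (ψ : AddChar F ℂ) (hψ : ψ ≠ 1) (Q : QuadraticForm F (Fin d → F))
    (hQ : ∀ x, (∀ y, QuadraticMap.polar (⇑Q) x y = 0) → x = 0) (k f g : (Fin d → F) → ℝ)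
    (M : ℝ) (hk : ∀ ξ, ‖ft ψ Q (fun x => (k x : ℂ)) ξ‖ ≤ M) :
    |∑ x, ∑ y, f x * g y * k (x - y)| ≤ M / 2 * (∑ x, f x ^ 2 + ∑ x, g x ^ 2) := by
  classical
  set N : ℝ := ((Fintype.card (Fin d → F) : ℕ) : ℝ) with hN
  have hNpos : 0 < N := by rw [hN]; exact_mod_cast Fintype.card_pos
  have hinv : ∀ z, (N : ℂ) * (k z : ℂ) = ∑ ξ, ft ψ Q (fun x => (k x : ℂ)) ξ * eB ψ Q ξ (-z) := by
    intro z
    unfold ft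
    simp only [Finset.sum_mul]
    rw [Finset.sum_comm]
    have : ∀ y, ∑ ξ, (k y : ℂ) * eB ψ Q ξ y * eB ψ Q ξ (-z) =
        (k y : ℂ) * (if y = z then (N : ℂ) else 0) := by
      intro y
      have h := eB_sum ψ hψ Q hQ (y - z)
      simp only [sub_eq_zero] at h
      rw [hN, Complex.ofReal_natCast, ← h, Finset.mul_sum]
      refine Finset.sum_congr rfl fun ξ _ => ?_
      rw [mul_assoc, ← AddChar.map_add_eq_mul, ← sub_eq_add_neg, eB_comm]
    simp only [this]
    simp [mul_comm]
  have hmain : (N : ℂ) * ((∑ x, ∑ y, f x * g y * k (x - y) : ℝ) : ℂ) =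
      ∑ ξ, ft ψ Q (fun x => (k x : ℂ)) ξ * ((starRingEnd ℂ) (ft ψ Q (fun x => (f x : ℂ)) ξ) *
        ft ψ Q (fun x => (g x : ℂ)) ξ) := by
    have e1 : ∀ ξ, (starRingEnd ℂ) (ft ψ Q (fun x => (f x : ℂ)) ξ) * ft ψ Q (fun x => (g x : ℂ)) ξ
        = ∑ x, ∑ y, (f x : ℂ) * g y * eB ψ Q ξ (-(x - y)) := by
      intro ξ
      unfold ft
      rw [map_sum, Finset.sum_mul_sum]
      refine Finset.sum_congr rfl fun x _ => Finset.sum_congr rfl fun y _ => ?_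
      rw [map_mul, eB_conj, Complex.conj_ofReal, neg_sub, sub_eq_add_neg, AddChar.map_add_eq_mul]
      ring
    simp only [e1, Complex.ofReal_sum, Complex.ofReal_mul, Finset.mul_sum]
    rw [Finset.sum_comm (s := univ) (t := univ) (f := fun ξ x => ∑ y, _)]
    refine Finset.sum_congr rfl fun x _ => ?_
    rw [Finset.sum_comm]
    refine Finset.sum_congr rfl fun y _ => ?_
    have := hinv (x - y)
    calc (N : ℂ) * ((f x : ℂ) * g y * k (x - y)) = (f x : ℂ) * g y * (N * k (x - y)) := by ring
      _ = _ := by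
        rw [this, Finset.mul_sum]
        refine Finset.sum_congr rfl fun ξ _ => ?_
        ring
  have hM0 : 0 ≤ M := (norm_nonneg _).trans (hk 0)
  have hn : N * |∑ x, ∑ y, f x * g y * k (x - y)| ≤
      ∑ ξ, M * ((‖ft ψ Q (fun x => (f x : ℂ)) ξ‖ ^ 2 + ‖ft ψ Q (fun x => (g x : ℂ)) ξ‖ ^ 2) / 2) := by
    have h1 := congrArg norm hmain
    rw [norm_mul, Complex.norm_real, Complex.norm_real, Real.norm_eq_abs, Real.norm_eq_abs,
      abs_of_pos hNpos] at h1
    rw [h1]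
    refine (norm_sum_le _ _).trans (Finset.sum_le_sum fun ξ _ => ?_)
    rw [norm_mul, norm_mul, RCLike.norm_conj]
    refine mul_le_mul (hk ξ) ?_ (by positivity) hM0
    nlinarith [sq_nonneg (‖ft ψ Q (fun x => (f x : ℂ)) ξ‖ - ‖ft ψ Q (fun x => (g x : ℂ)) ξ‖)]
  rw [← Finset.mul_sum, ← Finset.sum_div, Finset.sum_add_distrib, ft_parseval ψ hψ Q hQ,
    ft_parseval ψ hψ Q hQ, ← hN] at hn
  refine le_of_mul_le_mul_left (hn.trans (le_of_eq ?_)) hNpos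
  ring

/-- Gauss sum of the quadratic form -/
noncomputable def gQ (ψ : AddChar F ℂ) (Q : QuadraticForm F (Fin d → F)) (s : F) : ℂ :=
  ∑ x, ψ (s * Q x)

theorem gQ_norm (ψ : AddChar F ℂ) (hψ : ψ ≠ 1) (Q : QuadraticForm F (Fin d → F))
    (hQ : ∀ x, (∀ y, QuadraticMap.polar (⇑Q) x y = 0) → x = 0) (s : F) (hs : s ≠ 0) :
    ‖gQ ψ Q s‖ = Real.sqrt (Fintype.card (Fin d → F)) := by
  classical
  have h : ((‖gQ ψ Q s‖ ^ 2 : ℝ) : ℂ) = (Fintype.card (Fin d → F) : ℂ) := by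
    rw [Complex.ofReal_pow, ← Complex.mul_conj']
    unfold gQ
    rw [map_sum, Finset.sum_mul_sum, Finset.sum_comm]
    have : ∀ y, ∑ x, ψ (s * Q x) * (starRingEnd ℂ) (ψ (s * Q y)) =
        ∑ u, ψ (s * Q u) * eB ψ Q (s • u) y := by
      intro y
      rw [← Equiv.sum_comp (Equiv.addRight y)]
      refine Finset.sum_congr rfl fun u _ => ?_
      rw [← AddChar.map_neg_eq_conj, ← AddChar.map_add_eq_mul, eB_apply, ← AddChar.map_add_eq_mul]
      congr 1
      rw [QuadraticMap.polar_smul_left]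
      simp only [Equiv.coe_addRight, smul_eq_mul, QuadraticMap.polar]
      ring
    simp only [this]
    rw [Finset.sum_comm]
    simp only [← Finset.mul_sum, eB_sum ψ hψ Q hQ, smul_eq_zero, hs, false_or]
    simp
  have h' : ‖gQ ψ Q s‖ ^ 2 = (Fintype.card (Fin d → F) : ℝ) := by exact_mod_cast h
  rw [← h', Real.sqrt_sq (norm_nonneg _)]

theorem gQ_sq (ψ : AddChar F ℂ) (Q : QuadraticForm F (Fin d → F)) (s c : F) (hc : c ≠ 0) :
    gQ ψ Q (s * (c * c)) = gQ ψ Q s := by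
  unfold gQ
  rw [← Equiv.sum_comp (LinearEquiv.smulOfNeZero F (Fin d → F) c hc).toEquiv
    (fun x => ψ (s * Q x))]
  refine Finset.sum_congr rfl fun x _ => ?_
  simp only [LinearEquiv.coe_toEquiv, LinearEquiv.smulOfNeZero_apply, QuadraticMap.map_smul, smul_eq_mul]
  rw [mul_assoc]

theorem gQ_decomp (h2 : ringChar F ≠ 2) (ψ : AddChar F ℂ) (hψ : ψ ≠ 1)
    (Q : QuadraticForm F (Fin d → F))
    (hQ : ∀ x, (∀ y, QuadraticMap.polar (⇑Q) x y = 0) → x = 0) :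
    ∃ A B : ℂ, ‖A‖ ≤ Real.sqrt (Fintype.card (Fin d → F)) ∧
      ‖B‖ ≤ Real.sqrt (Fintype.card (Fin d → F)) ∧
      ∀ s : F, s ≠ 0 → gQ ψ Q s = A + B * etaC F s := by
  classical
  obtain ⟨ν, hν⟩ := quadraticChar_exists_neg_one h2
  have hν0 : ν ≠ 0 := by rintro rfl; simp at hν
  have n1 := gQ_norm ψ hψ Q hQ 1 one_ne_zero
  have n2 := gQ_norm ψ hψ Q hQ ν hν0
  refine ⟨(gQ ψ Q 1 + gQ ψ Q ν) / 2, (gQ ψ Q 1 - gQ ψ Q ν) / 2, ?_, ?_, ?_⟩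
  · rw [norm_div]
    have := norm_add_le (gQ ψ Q 1) (gQ ψ Q ν)
    rw [n1, n2] at this
    rw [Complex.norm_ofNat]; linarith
  · rw [norm_div]
    have := norm_sub_le (gQ ψ Q 1) (gQ ψ Q ν)
    rw [n1, n2] at this
    rw [Complex.norm_ofNat]; linarith
  · intro s hs
    by_cases hsq : IsSquare s
    · have : etaC F s = 1 := by
        rw [etaC_apply, (quadraticChar_one_iff_isSquare hs).2 hsq]; simp
      obtain ⟨c, rfl⟩ := hsq
      have hc : c ≠ 0 := by rintro rfl; simp at hs
      rw [this]
      have := gQ_sq ψ Q 1 c hc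
      rw [one_mul] at this
      rw [this]; ring
    · have h3 := quadraticChar_neg_one_iff_not_isSquare.2 hsq
      have : etaC F s = -1 := by
        rw [etaC_apply, h3]; simp
      have hsν : IsSquare (s * ν) := by
        rw [← quadraticChar_one_iff_isSquare (mul_ne_zero hs hν0), map_mul, h3, hν]; norm_num
      obtain ⟨c, hc⟩ := hsν
      have hc0 : c ≠ 0 := by rintro rfl; simp [hs, hν0] at hc
      have e : s = ν * ((c / ν) * (c / ν)) := by
        field_simp
        rw [sq, ← hc]
      rw [this, e, gQ_sq ψ Q ν (c / ν) (div_ne_zero hc0 hν0)]; ring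

open Classical in
/-- kernel -/
noncomputable def ker (Q : QuadraticForm F (Fin d → F)) (l : F) (x : Fin d → F) : ℝ :=
  (if Q x = l then 1 else 0) - (Fintype.card F : ℝ)⁻¹

open Classical in
theorem ker_expand (ψ : AddChar F ℂ) (hψ : ψ ≠ 1) (Q : QuadraticForm F (Fin d → F)) (l : F)
    (x : Fin d → F) : (Fintype.card F : ℂ) * (ker Q l x : ℂ) =
      ∑ s : F, (if s = 0 then 0 else ψ (s * (Q x - l))) := by
  classical
  have hprim : ψ.IsPrimitive := AddChar.IsPrimitive.of_ne_one hψ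
  have h := AddChar.sum_mulShift (Q x - l) hprim
  have hq : (Fintype.card F : ℂ) ≠ 0 := by exact_mod_cast Fintype.card_ne_zero
  have h1 : ∑ s : F, (if s = 0 then 0 else ψ (s * (Q x - l))) = ∑ s : F, ψ (s * (Q x - l)) - 1 := by
    rw [eq_sub_iff_add_eq, ← Finset.add_sum_erase univ (fun s => ψ (s * (Q x - l))) (mem_univ 0),
      ← Finset.add_sum_erase univ _ (mem_univ 0)]
    simp only [if_true, zero_mul, AddChar.map_zero_eq_one, zero_add]
    rw [add_comm]
    congr 1
    refine Finset.sum_congr rfl fun s hs => ?_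
    rw [if_neg (Finset.ne_of_mem_erase hs)]
  rw [h1, h]
  unfold ker
  simp only [sub_eq_zero]
  split_ifs
  · push_cast; field_simp
  · push_cast; field_simp; ring

theorem ker_ft (h2 : ringChar F ≠ 2) (h3 : 3 ≤ Fintype.card F) (ψ : AddChar F ℂ) (hψ : ψ ≠ 1)
    (Q : QuadraticForm F (Fin d → F))
    (hQ : ∀ x, (∀ y, QuadraticMap.polar (⇑Q) x y = 0) → x = 0) (l : F) (hl : l ≠ 0)
    (ξ : Fin d → F) :
    ‖ft ψ Q (fun x => (ker Q l x : ℂ)) ξ‖ ≤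
      4 * Real.sqrt (Fintype.card (Fin d → F)) / Real.sqrt (Fintype.card F) := by
  classical
  obtain ⟨A, B, hA, hB, hAB⟩ := gQ_decomp h2 ψ hψ Q hQ
  have hqpos : (0 : ℝ) < Fintype.card F := by exact_mod_cast Fintype.card_pos
  have hsq : 0 < Real.sqrt (Fintype.card F) := Real.sqrt_pos.2 hqpos
  have key : (Fintype.card F : ℂ) * ft ψ Q (fun x => (ker Q l x : ℂ)) ξ =
      A * klo ψ (-l) (-Q ξ) + B * sal ψ (-l) (-Q ξ) := by
    unfold ft klo sal
    rw [sum_units_eq (fun s : F => ψ (-l * s + -Q ξ * s⁻¹)), Finset.mul_sum, Finset.mul_sum,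
      Finset.mul_sum, ← Finset.sum_add_distrib]
    have e1 : ∀ x, (Fintype.card F : ℂ) * ((ker Q l x : ℂ) * eB ψ Q ξ x) =
        ∑ s : F, (if s = 0 then 0 else ψ (s * (Q x - l))) * eB ψ Q ξ x := by
      intro x
      rw [← mul_assoc, ker_expand ψ hψ, Finset.sum_mul]
    simp only [e1]
    rw [Finset.sum_comm]
    refine Finset.sum_congr rfl fun s _ => ?_
    by_cases hs : s = 0
    · simp [hs, MulChar.map_zero]
    · simp only [if_neg hs]
      have e2 : ∑ x, ψ (s * (Q x - l)) * eB ψ Q ξ x = ψ (-l * s + -Q ξ * s⁻¹) * gQ ψ Q s := by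
        unfold gQ
        rw [← Equiv.sum_comp (Equiv.addRight (s⁻¹ • ξ)) (fun x => ψ (s * Q x)), Finset.mul_sum]
        refine Finset.sum_congr rfl fun x _ => ?_
        rw [eB_apply, ← AddChar.map_add_eq_mul, ← AddChar.map_add_eq_mul]
        congr 1
        simp only [Equiv.coe_addRight]
        have e3 : Q (x + s⁻¹ • ξ) = Q x + s⁻¹ * s⁻¹ * Q ξ + s⁻¹ * QuadraticMap.polar Q ξ x := by
          rw [QuadraticMap.polar_comm, QuadraticMap.map_add Q, QuadraticMap.map_smul,
            QuadraticMap.polar_smul_right, smul_eq_mul, smul_eq_mul]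
        rw [e3]
        field_simp
        ring
      rw [e2, hAB s hs]; ring
  have hk : ‖klo ψ (-l) (-Q ξ)‖ ≤ 2 * Real.sqrt (Fintype.card F) := by
    by_cases h0 : Q ξ = 0
    · have h1q : 1 ≤ Real.sqrt (Fintype.card F) := by
        rw [Real.one_le_sqrt]; exact_mod_cast Fintype.card_pos
      have : klo ψ (-l) (-Q ξ) = -1 := by
        have e := ker_expand ψ hψ (0 : QuadraticForm F (Fin d → F)) l 0
        unfold klo
        rw [sum_units_eq (fun s : F => ψ (-l * s + -Q ξ * s⁻¹))]
        have e' : ∀ s : F, (if s = 0 then (0:ℂ) else ψ (-l * s + -Q ξ * s⁻¹)) =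
            (if s = 0 then 0 else ψ (s * ((0 : QuadraticForm F (Fin d → F)) 0 - l))) := by
          intro s
          rw [h0]
          simp [mul_comm]
        rw [Finset.sum_congr rfl (fun s _ => e' s), ← e]
        unfold ker
        have : (Fintype.card F : ℂ) ≠ 0 := by exact_mod_cast Fintype.card_ne_zero
        simp [hl.symm, this]
      rw [this, norm_neg, norm_one]
      linarith
    · exact klo_bound h3 ψ hψ _ _ (neg_ne_zero.2 hl) (neg_ne_zero.2 h0)
  have hs := sal_bound h2 ψ hψ (-l) (-Q ξ) (neg_ne_zero.2 hl)
  have hn := congrArg norm key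
  rw [norm_mul, Complex.norm_natCast] at hn
  have hle : ‖A * klo ψ (-l) (-Q ξ) + B * sal ψ (-l) (-Q ξ)‖ ≤
      Real.sqrt (Fintype.card (Fin d → F)) * (2 * Real.sqrt (Fintype.card F)) +
      Real.sqrt (Fintype.card (Fin d → F)) * (2 * Real.sqrt (Fintype.card F)) := by
    refine (norm_add_le _ _).trans ?_
    rw [norm_mul, norm_mul]
    gcongr
  rw [← hn] at hle
  rw [le_div_iff₀ hsq]
  have hq2 : (Fintype.card F : ℝ) = Real.sqrt (Fintype.card F) * Real.sqrt (Fintype.card F) :=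
    (Real.mul_self_sqrt hqpos.le).symm
  refine le_of_mul_le_mul_right ?_ hsq
  rw [mul_assoc, ← hq2]
  linarith

theorem op_bound (h2 : ringChar F ≠ 2) (h3 : 3 ≤ Fintype.card F)
    (Q : QuadraticForm F (Fin d → F))
    (hQ : ∀ x, (∀ y, QuadraticMap.polar (⇑Q) x y = 0) → x = 0) (l : F) (hl : l ≠ 0)
    (f g : (Fin d → F) → ℝ) :
    |∑ x, ∑ y, f x * g y * ker Q l (x - y)| ≤
      (4 * Real.sqrt (Fintype.card (Fin d → F)) / Real.sqrt (Fintype.card F)) / 2 *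
        (∑ x, f x ^ 2 + ∑ x, g x ^ 2) := by
  obtain ⟨ψ, hψ⟩ : ∃ ψ : AddChar F ℂ, ψ ≠ 1 := by
    refine ⟨AddChar.FiniteField.primitiveChar_to_Complex F, ?_⟩
    have := AddChar.FiniteField.primitiveChar_to_Complex_isPrimitive F
    have h1 := this one_ne_zero
    rwa [AddChar.mulShift_one] at h1
  exact conv_bound ψ hψ Q hQ (ker Q l) f g _ (ker_ft h2 h3 ψ hψ Q hQ l hl)

end Spectral
open Finset

section Comb

variable {V : Type} [Fintype V] {n : ℕ}

theorem sum_update (H : (Fin n → V) → ℝ) (i : Fin n) :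
    ∑ x, ∑ u, H (Function.update x i u) = Fintype.card V * ∑ x, H x := by
  classical
  have h1 : ∑ x, ∑ u, H (Function.update x i u) =
      ∑ p : (Fin n → V) × V, H (Function.update p.1 i p.2) := by
    rw [Fintype.sum_prod_type]
  have h2 : ∑ p : (Fin n → V) × V, H (Function.update p.1 i p.2) =
      ∑ p : (Fin n → V) × V, H p.1 := by
    refine Finset.sum_bij' (fun p _ => (Function.update p.1 i p.2, p.1 i))
      (fun p _ => (Function.update p.1 i p.2, p.1 i)) ?_ ?_ ?_ ?_ ?_
    · intros; simp
    · intros; simp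
    · intro p _; simp
    · intro p _; simp
    · intro p _; rfl
  rw [h1, h2, Fintype.sum_prod_type]
  simp [Finset.mul_sum]

open Classical in
noncomputable def indA (A : Finset V) (v : V) : ℝ := if v ∈ A then 1 else 0

theorem sum_indA (A : Finset V) : ∑ v, indA A v = A.card := by
  classical
  simp [indA]

theorem indA_sq (A : Finset V) (v : V) : indA A v * indA A v = indA A v := by
  unfold indA; split_ifs <;> simp

theorem indA_nonneg (A : Finset V) (v : V) : 0 ≤ indA A v := by
  unfold indA; split_ifs <;> simp

theorem indA_le (A : Finset V) (v : V) : indA A v ≤ 1 := by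
  unfold indA; split_ifs <;> simp

theorem sum_indep (A : Finset V) (h : (Fin n → V) → ℝ) (j : Fin n)
    (hj : ∀ x u, h (Function.update x j u) = h x) :
    Fintype.card V * ∑ x, h x * indA A (x j) = A.card * ∑ x, h x := by
  rw [← sum_update _ j]
  simp only [hj, Function.update_self, ← Finset.mul_sum, sum_indA]
  rw [← Finset.sum_mul, mul_comm]

theorem edge_abs (A : Finset V) (i j : Fin n) (hij : i ≠ j) (w f g : (Fin n → V) → ℝ)
    (k : V → V → ℝ) (M : ℝ)
    (hk : ∀ f g : V → ℝ, |∑ x, ∑ y, f x * g y * k x y| ≤ M / 2 * (∑ x, f x ^ 2 + ∑ x, g x ^ 2))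
    (w0 : ∀ x, 0 ≤ w x)
    (wi : ∀ x u, w (Function.update x i u) = w x) (wj : ∀ x u, w (Function.update x j u) = w x)
    (fj : ∀ x u, f (Function.update x j u) = f x) (gi : ∀ x u, g (Function.update x i u) = g x)
    (ff : ∀ x, f x ^ 2 = f x) (gg : ∀ x, g x ^ 2 = g x) :
    A.card * |∑ x, w x * f x * g x * k (x i) (x j)| ≤
      M / 2 * (∑ x, w x * f x * indA A (x j) + ∑ x, w x * g x * indA A (x i)) := by
  rcases isEmpty_or_nonempty V with hV | hV
  · have : IsEmpty (Fin n → V) := ⟨fun x => hV.elim (x i)⟩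
    simp
  have hc : (0 : ℝ) < Fintype.card V := by exact_mod_cast Fintype.card_pos
  set c : ℝ := ((Fintype.card V : ℕ) : ℝ) with hcdef
  have h1 : c * (c * ∑ x, w x * f x * g x * k (x i) (x j)) =
      ∑ x, w x * ∑ u, ∑ v, f (Function.update x i u) * g (Function.update x j v) * k u v := by
    rw [← sum_update _ j, ← sum_update _ i]
    refine Finset.sum_congr rfl fun x _ => ?_
    rw [Finset.mul_sum]
    refine Finset.sum_congr rfl fun u _ => ?_
    rw [Finset.mul_sum]
    refine Finset.sum_congr rfl fun v _ => ?_
    have e1 : g (Function.update (Function.update x i u) j v) = g (Function.update x j v) := by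
      rw [Function.update_comm hij, gi]
    rw [e1, wj, wi, fj, Function.update_self, Function.update_of_ne hij, Function.update_self]
    ring
  have hF : ∑ x, w x * ∑ u, f (Function.update x i u) = c * ∑ x, w x * f x := by
    rw [← sum_update _ i]
    refine Finset.sum_congr rfl fun x _ => ?_
    simp only [wi, Finset.mul_sum]
  have hG : ∑ x, w x * ∑ u, g (Function.update x j u) = c * ∑ x, w x * g x := by
    rw [← sum_update _ j]
    refine Finset.sum_congr rfl fun x _ => ?_
    simp only [wj, Finset.mul_sum]
  have h2 : c * (c * |∑ x, w x * f x * g x * k (x i) (x j)|) ≤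
      M / 2 * (c * ∑ x, w x * f x + c * ∑ x, w x * g x) := by
    have : c * (c * |∑ x, w x * f x * g x * k (x i) (x j)|) =
        |c * (c * ∑ x, w x * f x * g x * k (x i) (x j))| := by
      rw [abs_mul, abs_mul, abs_of_pos hc]
    rw [this, h1, ← hF, ← hG, ← Finset.sum_add_distrib, Finset.mul_sum]
    refine (Finset.abs_sum_le_sum_abs _ _).trans (Finset.sum_le_sum fun x _ => ?_)
    rw [abs_mul, abs_of_nonneg (w0 x)]
    have := mul_le_mul_of_nonneg_left (hk (fun u => f (Function.update x i u))
      (fun v => g (Function.update x j v))) (w0 x)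
    simp only [ff, gg] at this
    linarith
  have s1 := sum_indep A (fun x => w x * f x) j (fun x u => by simp only [wj, fj])
  have s2 := sum_indep A (fun x => w x * g x) i (fun x u => by simp only [wi, gi])
  rw [← hcdef] at s1 s2
  have hA : (0 : ℝ) ≤ A.card := Nat.cast_nonneg _
  have h3 := mul_le_mul_of_nonneg_left h2 hA
  have h4 : (c * c) * (A.card * |∑ x, w x * f x * g x * k (x i) (x j)|) ≤
      (c * c) * (M / 2 * (∑ x, w x * f x * indA A (x j) + ∑ x, w x * g x * indA A (x i))) := by
    calc _ ≤ _ := (le_of_eq (by ring)).trans h3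
      _ = M / 2 * (c * (A.card * ∑ x, w x * f x) + c * (A.card * ∑ x, w x * g x)) := by ring
      _ = _ := by rw [← s1, ← s2]; ring
  exact le_of_mul_le_mul_left h4 (by positivity)

/-- weight of a configuration -/
noncomputable def wt (A : Finset V) (K : Fin n × Fin n → V → V → ℝ) (E : Finset (Fin n × Fin n))
    (x : Fin n → V) : ℝ :=
  (∏ v, indA A (x v)) * ∏ e ∈ E, K e (x e.1) (x e.2)

noncomputable def cnt (A : Finset V) (K : Fin n × Fin n → V → V → ℝ) (E : Finset (Fin n × Fin n)) :
    ℝ := ∑ x, wt A K E x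

/-- remove edges at v -/
def rem (E : Finset (Fin n × Fin n)) (v : Fin n) : Finset (Fin n × Fin n) :=
  E.filter (fun e => e.1 ≠ v ∧ e.2 ≠ v)

theorem cnt_empty (A : Finset V) (K : Fin n × Fin n → V → V → ℝ) :
    cnt A K ∅ = (A.card : ℝ) ^ n := by
  classical
  unfold cnt wt
  simp only [Finset.prod_empty, mul_one]
  have := Finset.prod_univ_sum (fun _ : Fin n => (univ : Finset V)) (fun _ v => indA A v)
  rw [Fintype.piFinset_univ] at this
  rw [← this]
  simp [sum_indA]

theorem prod_sq_self {ι : Type} (s : Finset ι) (f : ι → ℝ) (h : ∀ i, f i * f i = f i) :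
    (∏ i ∈ s, f i) ^ 2 = ∏ i ∈ s, f i := by
  rw [sq, ← Finset.prod_mul_distrib]
  exact Finset.prod_congr rfl fun i _ => h i

theorem prodK_update (K : Fin n × Fin n → V → V → ℝ) (S : Finset (Fin n × Fin n)) (j : Fin n)
    (hS : ∀ e ∈ S, e.1 ≠ j ∧ e.2 ≠ j) (x : Fin n → V) (u : V) :
    ∏ e ∈ S, K e (Function.update x j u e.1) (Function.update x j u e.2) =
      ∏ e ∈ S, K e (x e.1) (x e.2) := by
  refine Finset.prod_congr rfl fun e he => ?_
  rw [Function.update_of_ne (hS e he).1, Function.update_of_ne (hS e he).2]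

theorem prodA_update (A : Finset V) (S : Finset (Fin n)) (j : Fin n)
    (hS : j ∉ S) (x : Fin n → V) (u : V) :
    ∏ v ∈ S, indA A (Function.update x j u v) = ∏ v ∈ S, indA A (x v) := by
  refine Finset.prod_congr rfl fun v hv => ?_
  rw [Function.update_of_ne]
  rintro rfl; exact hS hv

theorem edge_step (A : Finset V) (K : Fin n × Fin n → V → V → ℝ)
    (K2 : ∀ e x y, K e x y * K e x y = K e x y)
    (E : Finset (Fin n × Fin n)) (hE : ∀ e ∈ E, e.1 < e.2) (κ M : ℝ) (e : Fin n × Fin n) (he : e ∈ E)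
    (hk : ∀ f g : V → ℝ, |∑ x, ∑ y, f x * g y * (K e x y - κ)| ≤
      M / 2 * (∑ x, f x ^ 2 + ∑ x, g x ^ 2)) :
    A.card * |cnt A K E - κ * cnt A K (E.erase e)| ≤
      M / 2 * (cnt A K (rem E e.1) + cnt A K (rem E e.2)) := by
  classical
  obtain ⟨i, j⟩ := e
  have hij : i < j := hE _ he
  have hne : i ≠ j := hij.ne
  have K0 : ∀ e x y, 0 ≤ K e x y := fun e x y => by rw [← K2]; exact mul_self_nonneg _
  set E0 := E.filter (fun e => (e.1 ≠ i ∧ e.2 ≠ i) ∧ (e.1 ≠ j ∧ e.2 ≠ j)) with hE0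
  set Ei := E.filter (fun e => ¬(e.1 ≠ i ∧ e.2 ≠ i) ∧ (e.1 ≠ j ∧ e.2 ≠ j)) with hEi
  set Ej := E.filter (fun e => (e.1 ≠ i ∧ e.2 ≠ i) ∧ ¬(e.1 ≠ j ∧ e.2 ≠ j)) with hEj
  set P : Finset (Fin n × Fin n) → (Fin n → V) → ℝ := fun S x => ∏ e ∈ S, K e (x e.1) (x e.2) with hP
  set R : (Fin n → V) → ℝ := fun x => ∏ v ∈ (univ.erase i).erase j, indA A (x v) with hR
  have hprod : ∀ x : Fin n → V, ∏ v, indA A (x v) = indA A (x i) * indA A (x j) * R x := by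
    intro x
    rw [← Finset.mul_prod_erase univ _ (mem_univ i),
      ← Finset.mul_prod_erase (univ.erase i) _ (Finset.mem_erase.2 ⟨hne.symm, mem_univ j⟩)]
    ring
  have remi : rem E i = E0 ∪ Ej := by
    ext e; simp only [rem, hE0, hEj, mem_union, mem_filter]; tauto
  have remj : rem E j = E0 ∪ Ei := by
    ext e; simp only [rem, hE0, hEi, mem_union, mem_filter]; tauto
  have di : Disjoint E0 Ej := by
    rw [Finset.disjoint_left]; intro e; simp only [hE0, hEj, mem_filter]; tauto
  have dj : Disjoint E0 Ei := by
    rw [Finset.disjoint_left]; intro e; simp only [hE0, hEi, mem_filter]; tauto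
  have dij : Disjoint (E0 ∪ Ei) Ej := by
    rw [Finset.disjoint_left]; intro e; simp only [hE0, hEi, hEj, mem_union, mem_filter]; tauto
  have hall : E.erase (i, j) = (E0 ∪ Ei) ∪ Ej := by
    ext ⟨a, b⟩
    simp only [hE0, hEi, hEj, mem_union, mem_filter, mem_erase, ne_eq, Prod.mk.injEq]
    constructor
    · rintro ⟨h1, h2⟩
      have h3 : a < b := hE _ h2
      have : ¬ (¬ (¬ a = i ∧ ¬ b = i) ∧ ¬ (¬ a = j ∧ ¬ b = j)) := by
        intro h
        simp only [Fin.lt_def, Fin.ext_iff] at *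
        omega
      tauto
    · rintro h
      have : ¬ (a = i ∧ b = j) := by
        rintro ⟨rfl, rfl⟩
        tauto
      tauto
  have hPu : ∀ S T : Finset (Fin n × Fin n), Disjoint S T → ∀ x, P (S ∪ T) x = P S x * P T x :=
    fun S T h x => Finset.prod_union h
  have key := edge_abs A i j hne (fun x => R x * P E0 x) (fun x => indA A (x i) * P Ei x)
    (fun x => indA A (x j) * P Ej x) (fun u v => K (i, j) u v - κ) M hk
    (fun x => mul_nonneg (Finset.prod_nonneg fun _ _ => indA_nonneg _ _)
      (Finset.prod_nonneg fun _ _ => K0 _ _ _))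
    (fun x u => by
      simp only [hR, hP]
      rw [prodA_update A _ i (by simp), prodK_update K E0 i (by intro e; simp only [hE0, mem_filter]; tauto)])
    (fun x u => by
      simp only [hR, hP]
      rw [prodA_update A _ j (by simp), prodK_update K E0 j (by intro e; simp only [hE0, mem_filter]; tauto)])
    (fun x u => by
      simp only [hP]
      rw [Function.update_of_ne hne, prodK_update K Ei j (by intro e; simp only [hEi, mem_filter]; tauto)])
    (fun x u => by
      simp only [hP]
      rw [Function.update_of_ne hne.symm, prodK_update K Ej i (by intro e; simp only [hEj, mem_filter]; tauto)])
    (fun x => by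
      rw [mul_pow, sq (indA _ _), indA_sq]
      rw [prod_sq_self _ _ (fun e => K2 _ _ _)])
    (fun x => by
      rw [mul_pow, sq (indA _ _), indA_sq]
      rw [prod_sq_self _ _ (fun e => K2 _ _ _)])
  have c1 : cnt A K E - κ * cnt A K (E.erase (i, j)) =
      ∑ x, R x * P E0 x * (indA A (x i) * P Ei x) * (indA A (x j) * P Ej x) *
        (K (i, j) (x i) (x j) - κ) := by
    unfold cnt wt
    rw [Finset.mul_sum, ← Finset.sum_sub_distrib]
    refine Finset.sum_congr rfl fun x _ => ?_
    rw [← Finset.mul_prod_erase E _ he, hprod]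
    have : ∏ e ∈ E.erase (i, j), K e (x e.1) (x e.2) = P E0 x * P Ei x * P Ej x := by
      rw [← hPu _ _ dj, ← hPu _ _ dij, ← hall]
    rw [this]
    ring
  have c2 : cnt A K (rem E i) = ∑ x, R x * P E0 x * (indA A (x j) * P Ej x) * indA A (x i) := by
    unfold cnt wt
    refine Finset.sum_congr rfl fun x _ => ?_
    have : ∏ e ∈ rem E i, K e (x e.1) (x e.2) = P E0 x * P Ej x := by
      rw [remi, ← hPu _ _ di]
    rw [this, hprod]; ring
  have c3 : cnt A K (rem E j) = ∑ x, R x * P E0 x * (indA A (x i) * P Ei x) * indA A (x j) := by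
    unfold cnt wt
    refine Finset.sum_congr rfl fun x _ => ?_
    have : ∏ e ∈ rem E j, K e (x e.1) (x e.2) = P E0 x * P Ei x := by
      rw [remj, ← hPu _ _ dj]
    rw [this, hprod]; ring
  simp only
  rw [c1, c2, c3, add_comm]
  exact key

theorem coincide (A : Finset V) (K : Fin n × Fin n → V → V → ℝ)
    (K2 : ∀ e x y, K e x y * K e x y = K e x y)
    (E : Finset (Fin n × Fin n)) (i j : Fin n) (hij : i ≠ j) [DecidableEq V] :
    A.card * ∑ x, (if x i = x j then wt A K E x else 0) ≤ cnt A K (rem E j) := by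
  rcases isEmpty_or_nonempty V with hV | hV
  · have : IsEmpty (Fin n → V) := ⟨fun x => hV.elim (x i)⟩
    simp [cnt]
  have hc : (0 : ℝ) < Fintype.card V := by exact_mod_cast Fintype.card_pos
  set c : ℝ := ((Fintype.card V : ℕ) : ℝ) with hcdef
  have K0 : ∀ e x y, 0 ≤ K e x y := fun e x y => by rw [← K2]; exact mul_self_nonneg _
  have K1 : ∀ e x y, K e x y ≤ 1 := fun e x y => by nlinarith [K2 e x y, sq_nonneg (K e x y - 1)]
  set h : (Fin n → V) → ℝ := fun x => (∏ v ∈ univ.erase j, indA A (x v)) *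
    ∏ e ∈ rem E j, K e (x e.1) (x e.2) with hh
  have h0 : ∀ x, 0 ≤ h x := fun x => mul_nonneg (Finset.prod_nonneg fun _ _ => indA_nonneg _ _)
      (Finset.prod_nonneg fun _ _ => K0 _ _ _)
  have hj : ∀ x u, h (Function.update x j u) = h x := by
    intro x u
    simp only [hh]
    rw [prodA_update A _ j (by simp), prodK_update K _ j (by intro e; simp only [rem, mem_filter]; tauto)]
  have hw : ∀ x, wt A K (rem E j) x = h x * indA A (x j) := by
    intro x
    simp only [hh, wt]
    rw [← Finset.mul_prod_erase univ _ (mem_univ j)]; ring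
  have hle : ∀ x, wt A K E x ≤ h x := by
    intro x
    have h1 : wt A K E x ≤ wt A K (rem E j) x := by
      unfold wt
      refine mul_le_mul_of_nonneg_left ?_ (Finset.prod_nonneg fun _ _ => indA_nonneg _ _)
      rw [← Finset.prod_filter_mul_prod_filter_not E (fun e => e.1 ≠ j ∧ e.2 ≠ j)]
      exact mul_le_of_le_one_right (Finset.prod_nonneg fun _ _ => K0 _ _ _)
        (Finset.prod_le_one (fun _ _ => K0 _ _ _) (fun _ _ => K1 _ _ _))
    rw [hw] at h1
    exact h1.trans (mul_le_of_le_one_right (h0 x) (indA_le _ _))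
  have s1 := sum_indep A h j hj
  rw [← hcdef] at s1
  have s2 : c * ∑ x, (if x i = x j then h x else 0) = ∑ x, h x := by
    rw [← sum_update _ j]
    refine Finset.sum_congr rfl fun x _ => ?_
    simp only [hj, Function.update_self, Function.update_of_ne hij]
    simp
  have s3 : ∑ x, (if x i = x j then wt A K E x else 0) ≤ ∑ x, (if x i = x j then h x else 0) := by
    refine Finset.sum_le_sum fun x _ => ?_
    split_ifs
    · exact hle x
    · exact le_rfl
  have s4 : cnt A K (rem E j) = ∑ x, h x * indA A (x j) :=
    Finset.sum_congr rfl fun x _ => hw x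
  have hA : (0 : ℝ) ≤ A.card := Nat.cast_nonneg _
  refine le_of_mul_le_mul_left ?_ hc
  rw [s4, s1, ← s2]
  calc c * (A.card * ∑ x, (if x i = x j then wt A K E x else 0))
      ≤ c * (A.card * ∑ x, (if x i = x j then h x else 0)) := by gcongr
    _ = _ := by ring

end Comb
open Finset

section Comb2

variable {V : Type} [Fintype V] {n : ℕ}

theorem card_rem (E : Finset (Fin n × Fin n)) (v : Fin n) :
    E.card = (rem E v).card + (E.filter (fun e => ¬(e.1 ≠ v ∧ e.2 ≠ v))).card := by
  unfold rem
  rw [Finset.card_filter_add_card_filter_not]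

theorem cnt_main (A : Finset V) (K : Fin n × Fin n → V → V → ℝ)
    (K2 : ∀ e x y, K e x y * K e x y = K e x y) (q M : ℝ) (hq : 1 ≤ q) (hM : 0 ≤ M) (t m0 : ℕ)
    (hA : 0 < (A.card : ℝ)) (δ : ℝ) (hδ : 0 ≤ δ) (hmδ : m0 * δ ≤ 1 / 3)
    (hb : 2 * (M * q ^ t) ≤ δ * A.card)
    (E0 : Finset (Fin n × Fin n))
    (hk : ∀ e ∈ E0, ∀ f g : V → ℝ, |∑ x, ∑ y, f x * g y * (K e x y - q⁻¹)| ≤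
      M / 2 * (∑ x, f x ^ 2 + ∑ x, g x ^ 2)) :
    ∀ k : ℕ, ∀ E : Finset (Fin n × Fin n), E.card = k → k ≤ m0 → E ⊆ E0 →
      (∀ e ∈ E, e.1 < e.2) →
      (∀ v, (E.filter (fun e => ¬(e.1 ≠ v ∧ e.2 ≠ v))).card ≤ t) →
      |cnt A K E - (A.card : ℝ) ^ n * q⁻¹ ^ k| ≤ k * δ * ((A.card : ℝ) ^ n * q⁻¹ ^ k) := by
  have hq0 : 0 < q := by linarith
  intro k
  induction k using Nat.strong_induction_on with
  | _ k ih =>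
  intro E hEk hkm hEE0 hlt hdeg
  rcases Finset.eq_empty_or_nonempty E with rfl | ⟨e, he⟩
  · simp at hEk
    subst hEk
    simp [cnt_empty]
  have hkpos : 0 < k := by rw [← hEk]; exact Finset.card_pos.2 ⟨e, he⟩
  obtain ⟨k', rfl⟩ : ∃ k', k = k' + 1 := ⟨k - 1, by omega⟩
  set T : ℝ := (A.card : ℝ) ^ n with hT
  have hTpos : 0 < T := by positivity
  have hstep := edge_step A K K2 E hlt q⁻¹ M e he (hk e (hEE0 he))
  have hsub : ∀ E' ⊆ E, ∀ v, (E'.filter (fun e => ¬(e.1 ≠ v ∧ e.2 ≠ v))).card ≤ t := fun E' h v =>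
    (Finset.card_le_card (Finset.filter_subset_filter _ h)).trans (hdeg v)
  have hrem : ∀ v, (v = e.1 ∨ v = e.2) → cnt A K (rem E v) ≤ 2 * (q ^ t * (T * q⁻¹ ^ (k' + 1))) := by
    intro v hv
    have hsubv : rem E v ⊆ E := Finset.filter_subset _ _
    have hcl : (rem E v).card < k' + 1 := by
      rw [← hEk]
      refine Finset.card_lt_card ⟨hsubv, fun h => ?_⟩
      have := h he
      simp only [rem, mem_filter] at this
      rcases hv with rfl | rfl <;> tauto
    have := ih _ hcl (rem E v) rfl (by omega) (hsubv.trans hEE0) (fun e h => hlt e (hsubv h))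
      (hsub _ hsubv)
    have h1 := (abs_le.1 this).2
    have hδ' : ((rem E v).card : ℝ) * δ ≤ 1 / 3 := by
      refine le_trans ?_ hmδ
      gcongr
      omega
    have hX : 0 ≤ T * q⁻¹ ^ (rem E v).card := by positivity
    have h2 : cnt A K (rem E v) ≤ 2 * (T * q⁻¹ ^ (rem E v).card) := by nlinarith
    refine h2.trans ?_
    have hcr := card_rem E v
    have hdv := hdeg v
    have : q⁻¹ ^ (rem E v).card ≤ q ^ t * q⁻¹ ^ (k' + 1) := by
      have e1 : q⁻¹ ^ (rem E v).card = q ^ t * q⁻¹ ^ ((rem E v).card + t) := by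
        rw [pow_add, mul_left_comm, ← mul_pow, mul_inv_cancel₀ hq0.ne']; simp
      rw [e1]
      refine mul_le_mul_of_nonneg_left ?_ (by positivity)
      exact pow_le_pow_of_le_one (by positivity) (inv_le_one_of_one_le₀ hq) (by omega)
    calc 2 * (T * q⁻¹ ^ (rem E v).card) ≤ 2 * (T * (q ^ t * q⁻¹ ^ (k' + 1))) := by gcongr
      _ = _ := by ring
  have r1 := hrem e.1 (Or.inl rfl)
  have r2 := hrem e.2 (Or.inr rfl)
  have her := ih k' (by omega) (E.erase e) (by rw [Finset.card_erase_of_mem he, hEk]; rfl) (by omega)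
    ((Finset.erase_subset _ _).trans hEE0) (fun e' h => hlt e' (Finset.mem_of_mem_erase h))
    (hsub _ (Finset.erase_subset _ _))
  set X : ℝ := T * q⁻¹ ^ (k' + 1) with hX
  have hXpos : 0 < X := by positivity
  have hXk : T * q⁻¹ ^ k' * q⁻¹ = X := by rw [hX, pow_succ]; ring
  have a1 : |cnt A K E - q⁻¹ * cnt A K (E.erase e)| ≤ δ * X := by
    have : A.card * |cnt A K E - q⁻¹ * cnt A K (E.erase e)| ≤ A.card * (δ * X) := by
      refine hstep.trans ?_
      calc M / 2 * (cnt A K (rem E e.1) + cnt A K (rem E e.2))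
          ≤ M / 2 * (2 * (q ^ t * X) + 2 * (q ^ t * X)) := by gcongr
        _ = 2 * (M * q ^ t) * X := by ring
        _ ≤ δ * A.card * X := by gcongr
        _ = _ := by ring
    exact le_of_mul_le_mul_left this hA
  have a2 : |q⁻¹ * cnt A K (E.erase e) - X| ≤ k' * δ * X := by
    have : q⁻¹ * cnt A K (E.erase e) - X = q⁻¹ * (cnt A K (E.erase e) - T * q⁻¹ ^ k') := by
      rw [← hXk]; ring
    rw [this, abs_mul, abs_of_pos (inv_pos.2 hq0)]
    calc q⁻¹ * |cnt A K (E.erase e) - T * q⁻¹ ^ k'| ≤ q⁻¹ * (k' * δ * (T * q⁻¹ ^ k')) := by gcongr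
      _ = k' * δ * (T * q⁻¹ ^ k' * q⁻¹) := by ring
      _ = _ := by rw [hXk]
  have := abs_sub_le (cnt A K E) (q⁻¹ * cnt A K (E.erase e)) X
  push_cast
  linarith

theorem inj_count (A : Finset V) [DecidableEq V] (K : Fin n × Fin n → V → V → ℝ)
    (K2 : ∀ e x y, K e x y * K e x y = K e x y) (q M : ℝ) (hq : 1 ≤ q) (hM : 0 ≤ M) (t : ℕ)
    (hn : 0 < n) (hA : 12 * (n : ℝ) ^ 2 * q ^ t ≤ A.card)
    (hb : M * q ^ t * (3 * (n : ℝ) ^ 2) ≤ A.card)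
    (E : Finset (Fin n × Fin n)) (hEn : 2 * E.card ≤ n ^ 2)
    (hlt : ∀ e ∈ E, e.1 < e.2)
    (hdeg : ∀ v, (E.filter (fun e => ¬(e.1 ≠ v ∧ e.2 ≠ v))).card ≤ t)
    (hk : ∀ e ∈ E, ∀ f g : V → ℝ, |∑ x, ∑ y, f x * g y * (K e x y - q⁻¹)| ≤
      M / 2 * (∑ x, f x ^ 2 + ∑ x, g x ^ 2)) :
    1 / 2 * ((A.card : ℝ) ^ n * q⁻¹ ^ E.card) ≤
      ∑ x : Fin n → V, (if Function.Injective x then wt A K E x else 0) := by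
  have hq0 : 0 < q := by linarith
  have hn' : (0 : ℝ) < n := by exact_mod_cast hn
  have hn1 : (1 : ℝ) ≤ n := by exact_mod_cast hn
  have hApos : (0 : ℝ) < A.card := lt_of_lt_of_le (by positivity) hA
  set δ : ℝ := 2 / (3 * (n : ℝ) ^ 2) with hδ
  have hδ0 : 0 ≤ δ := by positivity
  have hmδ : (E.card : ℝ) * δ ≤ 1 / 3 := by
    have : (2 : ℝ) * E.card ≤ (n : ℝ) ^ 2 := by exact_mod_cast hEn
    rw [hδ, mul_div_assoc', div_le_iff₀ (by positivity)]
    linarith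
  have main := cnt_main A K K2 q M hq hM t E.card hApos δ hδ0 hmδ (by
    rw [hδ, div_mul_eq_mul_div, le_div_iff₀ (by positivity)]
    linarith) E hk
  set T : ℝ := (A.card : ℝ) ^ n with hT
  have hTpos : 0 < T := by positivity
  set X : ℝ := T * q⁻¹ ^ E.card with hX
  have hXpos : 0 < X := by positivity
  have low : 2 / 3 * X ≤ cnt A K E := by
    have h := (abs_le.1 (main E.card E rfl le_rfl (subset_refl _) hlt hdeg)).1
    rw [← hX] at h
    nlinarith
  have hrem : ∀ v, cnt A K (rem E v) ≤ 2 * (q ^ t * X) := by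
    intro v
    have hsubv : rem E v ⊆ E := Finset.filter_subset _ _
    have hcl : (rem E v).card ≤ E.card := Finset.card_le_card hsubv
    have := main _ (rem E v) rfl hcl hsubv (fun e h => hlt e (hsubv h))
      (fun w => (Finset.card_le_card (Finset.filter_subset_filter _ hsubv)).trans (hdeg w))
    have h1 := (abs_le.1 this).2
    have hδ' : ((rem E v).card : ℝ) * δ ≤ 1 / 3 := by
      refine le_trans ?_ hmδ
      gcongr
    have hX : 0 ≤ T * q⁻¹ ^ (rem E v).card := by positivity
    have h2 : cnt A K (rem E v) ≤ 2 * (T * q⁻¹ ^ (rem E v).card) := by nlinarith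
    refine h2.trans ?_
    have hcr := card_rem E v
    have hdv := hdeg v
    have : q⁻¹ ^ (rem E v).card ≤ q ^ t * q⁻¹ ^ E.card := by
      have e1 : q⁻¹ ^ (rem E v).card = q ^ t * q⁻¹ ^ ((rem E v).card + t) := by
        rw [pow_add, mul_left_comm, ← mul_pow, mul_inv_cancel₀ hq0.ne']; simp
      rw [e1]
      refine mul_le_mul_of_nonneg_left ?_ (by positivity)
      exact pow_le_pow_of_le_one (by positivity) (inv_le_one_of_one_le₀ hq) (by omega)
    calc 2 * (T * q⁻¹ ^ (rem E v).card) ≤ 2 * (T * (q ^ t * q⁻¹ ^ E.card)) := by gcongr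
      _ = _ := by ring
  have hco : ∀ i j : Fin n, i ≠ j →
      ∑ x : Fin n → V, (if x i = x j then wt A K E x else 0) ≤ X / (6 * (n : ℝ) ^ 2) := by
    intro i j hij
    have h1 := (coincide A K K2 E i j hij).trans (hrem j)
    have hS0 : (A.card : ℝ) * ∑ x : Fin n → V, (if x i = x j then wt A K E x else 0) ≤
        A.card * (X / (6 * (n : ℝ) ^ 2)) := by
      refine h1.trans ?_
      rw [mul_div_assoc', le_div_iff₀ (by positivity)]
      calc 2 * (q ^ t * X) * (6 * (n : ℝ) ^ 2) = 12 * (n : ℝ) ^ 2 * q ^ t * X := by ring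
        _ ≤ _ := by gcongr
    exact le_of_mul_le_mul_left hS0 hApos
  have K0 : ∀ e x y, 0 ≤ K e x y := fun e x y => by rw [← K2]; exact mul_self_nonneg _
  have w0 : ∀ x, 0 ≤ wt A K E x := fun x =>
    mul_nonneg (Finset.prod_nonneg fun _ _ => indA_nonneg _ _) (Finset.prod_nonneg fun _ _ => K0 _ _ _)
  set D := (univ : Finset (Fin n × Fin n)).filter (fun p => p.1 ≠ p.2) with hD
  have hDc : (D.card : ℝ) ≤ (n : ℝ) ^ 2 := by
    have : D.card ≤ n ^ 2 := by
      refine (Finset.card_le_univ _).trans ?_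
      simp [sq]
    exact_mod_cast this
  have hpt : ∀ x : Fin n → V, wt A K E x ≤ (if Function.Injective x then wt A K E x else 0) +
      ∑ p ∈ D, (if x p.1 = x p.2 then wt A K E x else 0) := by
    intro x
    have hs : 0 ≤ ∑ p ∈ D, (if x p.1 = x p.2 then wt A K E x else 0) :=
      Finset.sum_nonneg fun p _ => by split_ifs; exacts [w0 x, le_rfl]
    split_ifs with h
    · linarith
    · rw [Function.Injective] at h
      push Not at h
      obtain ⟨a, b, hab, hne⟩ := h
      have := Finset.single_le_sum (f := fun p : Fin n × Fin n =>
        (if x p.1 = x p.2 then wt A K E x else 0))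
        (fun p _ => by split_ifs; exacts [w0 x, le_rfl])
        (show (a, b) ∈ D by simp [hD, hne])
      simp only [hab, if_true] at this
      linarith
  have hsum : cnt A K E ≤ ∑ x : Fin n → V, (if Function.Injective x then wt A K E x else 0) +
      ∑ p ∈ D, ∑ x : Fin n → V, (if x p.1 = x p.2 then wt A K E x else 0) := by
    rw [Finset.sum_comm, ← Finset.sum_add_distrib]
    exact Finset.sum_le_sum fun x _ => hpt x
  have hD2 : ∑ p ∈ D, ∑ x : Fin n → V, (if x p.1 = x p.2 then wt A K E x else 0) ≤ X / 6 := by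
    calc _ ≤ ∑ p ∈ D, X / (6 * (n : ℝ) ^ 2) :=
          Finset.sum_le_sum fun p hp => hco _ _ (Finset.mem_filter.1 hp).2
      _ = D.card * (X / (6 * (n : ℝ) ^ 2)) := by rw [Finset.sum_const, nsmul_eq_mul]
      _ ≤ (n : ℝ) ^ 2 * (X / (6 * (n : ℝ) ^ 2)) := by gcongr
      _ = X / 6 := by field_simp
  linarith

end Comb2
open Finset

/-- Lower bound on the number of genuine (injective) isometric copies
of a distance graph, quadratic form case. -/
theorem stmt8 (q d n m t : ℕ) (hd : 2 ≤ d) (hn : 0 < n) (ht : 0 < t)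
    (F : Type) [Field F] [Fintype F]
    (hq : Fintype.card F = q) (hodd : Odd q)
    (Q : QuadraticForm F (Fin d → F))
    (hQ : ∀ x, (∀ y, QuadraticMap.polar (⇑Q) x y = 0) → x = 0)
    (A : Finset (Fin d → F)) (α : ℝ)
    (hcard : (A.card : ℝ) = α * (q : ℝ) ^ d)
    (hα : α ≥ 12 * (n : ℝ) ^ 2 * (q : ℝ) ^ ((t : ℝ) - ((d : ℝ) + 1) / 2))
    (G : SimpleGraph (Fin n)) [DecidableRel G.Adj]
    (hm : G.edgeFinset.card = m)
    (hdeg : ∀ v, G.degree v ≤ t)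
    (lam : Fin n → Fin n → F)
    (hsymm : ∀ i j, lam i j = lam j i)
    (hlam : ∀ i j, G.Adj i j → lam i j ≠ 0) :
    ((Nat.card {ι : Fin n → (Fin d → F) // Function.Injective ι ∧ (∀ i, ι i ∈ A) ∧
        ∀ i j, G.Adj i j → Q (ι i - ι j) = lam i j} : ℝ)) ≥
      (1 / 2) * (A.card : ℝ) ^ n * (q : ℝ) ^ (-(m : ℝ)) := by
  classical
  have h1q : 1 < q := by rw [← hq]; exact Fintype.one_lt_card
  have h3 : 3 ≤ Fintype.card F := by
    rw [hq]
    obtain ⟨r, hr⟩ := hodd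
    omega
  have h2 : ringChar F ≠ 2 := by
    intro h
    have h5 := FiniteField.even_card_iff_char_two.1 h
    rw [hq] at h5
    obtain ⟨r, hr⟩ := hodd
    omega
  have hqR : (1 : ℝ) ≤ q := by exact_mod_cast h1q.le
  have hq0 : (0 : ℝ) < q := by linarith
  have hn' : (0 : ℝ) < n := by exact_mod_cast hn
  set K : Fin n × Fin n → (Fin d → F) → (Fin d → F) → ℝ :=
    fun e u v => if Q (u - v) = lam e.1 e.2 then 1 else 0 with hK
  have K2 : ∀ e x y, K e x y * K e x y = K e x y := by
    intro e x y; simp only [hK]; split_ifs <;> simp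
  set E : Finset (Fin n × Fin n) := univ.filter (fun e => e.1 < e.2 ∧ G.Adj e.1 e.2) with hE
  have hEm : E.card = m := by
    rw [← hm]
    refine Finset.card_bij (fun e _ => s(e.1, e.2)) ?_ ?_ ?_
    · intro e he
      simp only [hE, mem_filter] at he
      simp [he.2.2]
    · rintro ⟨a, b⟩ h1 ⟨c, e⟩ h2 h
      simp only [hE, mem_filter] at h1 h2
      simp only [Sym2.eq_iff] at h
      rcases h with ⟨rfl, rfl⟩ | ⟨rfl, rfl⟩
      · rfl
      · exact absurd h1.2.1 (not_lt.2 h2.2.1.le)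
    · intro s
      induction s using Sym2.ind with
      | _ a b =>
      intro h
      rw [SimpleGraph.mem_edgeFinset, SimpleGraph.mem_edgeSet] at h
      rcases lt_or_gt_of_ne h.ne with h' | h'
      · exact ⟨(a, b), by simp [hE, h, h'], rfl⟩
      · exact ⟨(b, a), by simp [hE, h.symm, h'], Sym2.eq_swap⟩
  have hEn : 2 * E.card ≤ n ^ 2 := by
    have h := SimpleGraph.card_edgeFinset_le_card_choose_two (G := G)
    rw [hm, ← hEm, Fintype.card_fin, Nat.choose_two_right] at h
    have h' : n * (n - 1) / 2 * 2 ≤ n * (n - 1) := Nat.div_mul_le_self _ _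
    have h'' : n * (n - 1) ≤ n ^ 2 := by rw [sq]; exact Nat.mul_le_mul_left _ (Nat.sub_le _ _)
    omega
  have hlt : ∀ e ∈ E, e.1 < e.2 := fun e he => (Finset.mem_filter.1 he).2.1
  have hdegE : ∀ v, (E.filter (fun e => ¬(e.1 ≠ v ∧ e.2 ≠ v))).card ≤ t := by
    intro v
    refine le_trans ?_ (hdeg v)
    rw [← SimpleGraph.card_neighborFinset_eq_degree]
    refine Finset.card_le_card_of_injOn (fun e => if e.1 = v then e.2 else e.1) ?_ ?_
    · rintro ⟨a, b⟩ h
      simp only [hE, coe_filter, mem_filter, mem_univ, true_and, Set.mem_ofPred_eq] at h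
      simp only [mem_coe, SimpleGraph.mem_neighborFinset]
      split_ifs with hav
      · subst hav; exact h.1.2
      · have : b = v := by tauto
        subst this; exact h.1.2.symm
    · rintro ⟨a, b⟩ h1 ⟨a', b'⟩ h2 h
      simp only [hE, coe_filter, mem_filter, mem_univ, true_and, Set.mem_ofPred_eq] at h1 h2
      simp only at h
      have l1 := h1.1.1
      have l2 := h2.1.1
      have o1 := h1.2
      have o2 := h2.2
      rw [Prod.mk.injEq]
      simp only [Fin.lt_def, Fin.ext_iff, ne_eq] at *
      split_ifs at h <;> omega
  set M : ℝ := 4 * Real.sqrt (Fintype.card (Fin d → F)) / Real.sqrt (Fintype.card F) with hM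
  have hM0 : 0 ≤ M := by positivity
  have hk : ∀ e ∈ E, ∀ f g : (Fin d → F) → ℝ, |∑ x, ∑ y, f x * g y * (K e x y - (q : ℝ)⁻¹)| ≤
      M / 2 * (∑ x, f x ^ 2 + ∑ x, g x ^ 2) := by
    intro e he f g
    have := op_bound h2 h3 Q hQ (lam e.1 e.2) (hlam _ _ (Finset.mem_filter.1 he).2.2) f g
    unfold ker at this
    rw [hq] at this
    rw [hM, hq]
    exact this
  have hMq : M = 4 * (q : ℝ) ^ (((d : ℝ) - 1) / 2) := by
    rw [hM, Fintype.card_fun, Fintype.card_fin, hq, mul_div_assoc, Real.sqrt_eq_rpow, Real.sqrt_eq_rpow,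
      Nat.cast_pow, ← Real.rpow_natCast, ← Real.rpow_mul hq0.le, ← Real.rpow_sub hq0]
    congr 2
    ring
  have hAlow : 12 * (n : ℝ) ^ 2 * ((q : ℝ) ^ t * (q : ℝ) ^ (((d : ℝ) - 1) / 2)) ≤ A.card := by
    rw [hcard]
    have e : (q : ℝ) ^ t * (q : ℝ) ^ (((d : ℝ) - 1) / 2) =
        (q : ℝ) ^ ((t : ℝ) - ((d : ℝ) + 1) / 2) * (q : ℝ) ^ d := by
      rw [← Real.rpow_natCast, ← Real.rpow_natCast, ← Real.rpow_add hq0, ← Real.rpow_add hq0]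
      congr 1
      ring
    rw [e, ← mul_assoc]
    exact mul_le_mul_of_nonneg_right hα (by positivity)
  have hp1 : (1 : ℝ) ≤ (q : ℝ) ^ (((d : ℝ) - 1) / 2) := by
    apply Real.one_le_rpow hqR
    have : (2 : ℝ) ≤ d := by exact_mod_cast hd
    linarith
  have hA1 : 12 * (n : ℝ) ^ 2 * (q : ℝ) ^ t ≤ A.card := by
    refine le_trans ?_ hAlow
    have : (0 : ℝ) ≤ (q : ℝ) ^ t := by positivity
    gcongr
    exact le_mul_of_one_le_right this hp1
  have hb : M * (q : ℝ) ^ t * (3 * (n : ℝ) ^ 2) ≤ A.card := by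
    refine le_trans (le_of_eq ?_) hAlow
    rw [hMq]; ring
  have fin := inj_count A K K2 q M hqR hM0 t hn hA1 hb E hEn hlt hdegE hk
  have hcnt : ∑ x : Fin n → (Fin d → F), (if Function.Injective x then wt A K E x else 0) =
      (Nat.card {ι : Fin n → (Fin d → F) // Function.Injective ι ∧ (∀ i, ι i ∈ A) ∧
        ∀ i j, G.Adj i j → Q (ι i - ι j) = lam i j} : ℝ) := by
    rw [Nat.card_eq_fintype_card, Fintype.card_subtype, ← Finset.sum_boole]
    refine Finset.sum_congr rfl fun x _ => ?_
    have hw : wt A K E x = if (∀ i, x i ∈ A) ∧ ∀ i j, G.Adj i j → Q (x i - x j) = lam i j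
        then 1 else 0 := by
      unfold wt
      have w1 : ∏ v, indA A (x v) = if ∀ i, x i ∈ A then 1 else 0 := by
        unfold indA
        split_ifs with h
        · exact Finset.prod_eq_one fun v _ => if_pos (h v)
        · push Not at h
          obtain ⟨v, hv⟩ := h
          exact Finset.prod_eq_zero (mem_univ v) (if_neg hv)
      have w2 : ∏ e ∈ E, K e (x e.1) (x e.2) =
          if ∀ e ∈ E, Q (x e.1 - x e.2) = lam e.1 e.2 then 1 else 0 := by
        simp only [hK]
        rw [Finset.prod_boole]
        congr
      have w3 : (∀ e ∈ E, Q (x e.1 - x e.2) = lam e.1 e.2) ↔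
          ∀ i j, G.Adj i j → Q (x i - x j) = lam i j := ?_
      · rw [w1, w2]
        simp only [w3]
        by_cases ha : ∀ i, x i ∈ A
        · simp [ha]
        · simp [ha]
      constructor
      · intro h i j hij
        rcases lt_or_gt_of_ne hij.ne with h' | h'
        · exact h (i, j) (by simp [hE, hij, h'])
        · have := h (j, i) (by simp [hE, hij.symm, h'])
          rw [← neg_sub, QuadraticMap.map_neg, this, hsymm]
      · intro h e he
        exact h _ _ (Finset.mem_filter.1 he).2.2
    rw [hw, ← ite_and]
  rw [hcnt, hEm] at fin
  rw [Real.rpow_neg hq0.le, Real.rpow_natCast, ← inv_pow, mul_assoc]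
  exact fin
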